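/- arXiv:1712.09949 — 2 statements merged into one kernel-verified Lean document; each statement's English description precedes it below -/
import Mathlib

section
/- Let V be a graded vector space concentrated in odd degrees. Suppose (A, d, f_A) and (B, d, f_B) are V-CDGAs that are quasi-isomorphic as CDGAs, and let γ: H*(A) → H*(B) denote the isomorphism in cohomology induced by the chain of quasi-isomorphisms. If γ ∘ f_A^# = f_B^#, then the Hirsch extensions (A ⊗ ∧V, d_{f_A}) and (B ⊗ ∧V, d_{f_B}) are quasi-isomorphic CDGAs. -/
open scoped Manifold

noncomputable section

/-! ## Commutative differential graded algebras over ℝ -/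

/-- A commutative differential graded algebra (CDGA) over `ℝ`: a nonnegatively graded
`ℝ`-algebra (the grading being an internal direct sum decomposition) which is
graded-commutative, together with a degree `1` derivation `d` squaring to zero. -/
structure CDGA where
  carrier : Type
  [ring : Ring carrier]
  [algebra : Algebra ℝ carrier]
  grading : ℕ → Submodule ℝ carrier
  one_mem : (1 : carrier) ∈ grading 0
  mul_mem : ∀ {m n : ℕ} {a b : carrier},
    a ∈ grading m → b ∈ grading n → a * b ∈ grading (m + n)
  internal : DirectSum.IsInternal grading
  gcomm : ∀ {m n : ℕ} {a b : carrier}, a ∈ grading m → b ∈ grading n →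
    a * b = ((-1 : ℝ) ^ (m * n)) • (b * a)
  d : carrier →ₗ[ℝ] carrier
  d_mem : ∀ {n : ℕ} {a : carrier}, a ∈ grading n → d a ∈ grading (n + 1)
  d_d : ∀ a, d (d a) = 0
  leibniz : ∀ {m : ℕ} {a : carrier}, a ∈ grading m → ∀ b,
    d (a * b) = d a * b + ((-1 : ℝ) ^ m) • (a * d b)

attribute [instance] CDGA.ring CDGA.algebra

namespace CDGA

/-- The `n`-cocycles of a CDGA. -/
def cocycles (S : CDGA) (n : ℕ) : Submodule ℝ S.carrier :=
  LinearMap.ker S.d ⊓ S.grading n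

/-- The `n`-coboundaries of a CDGA. -/
def coboundaries (S : CDGA) : ℕ → Submodule ℝ S.carrier
  | 0 => ⊥
  | n + 1 => (S.grading n).map S.d

/-- A CDGA is connected if its degree-0 part is spanned by the unit. -/
def Connected (S : CDGA) : Prop := S.grading 0 = Submodule.span ℝ {(1 : S.carrier)}

end CDGA

/-- The coboundaries of the subcomplex `P` of a CDGA (`P n` is the degree `n` part
of the subcomplex). -/
def subBound (S : CDGA) (P : ℕ → Submodule ℝ S.carrier) : ℕ → Submodule ℝ S.carrier
  | 0 => ⊥
  | n + 1 => (P n).map S.d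

/-- A morphism of CDGAs: an `ℝ`-algebra map preserving the grading and commuting
with the differentials. -/
structure CDGAHom (S T : CDGA) where
  toLin : S.carrier →ₗ[ℝ] T.carrier
  map_one : toLin 1 = 1
  map_mul : ∀ a b, toLin (a * b) = toLin a * toLin b
  map_grading : ∀ {n : ℕ} {a : S.carrier}, a ∈ S.grading n → toLin a ∈ T.grading n
  map_d : ∀ a, toLin (S.d a) = T.d (toLin a)

namespace CDGAHom

/-- A morphism of CDGAs is a quasi-isomorphism if it induces an isomorphism on all
cohomology groups (expressed at the level of cocycles and coboundaries). -/
def IsQuasiIso {S T : CDGA} (φ : CDGAHom S T) : Prop :=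
  ∀ n : ℕ,
    (∀ x ∈ S.cocycles n, φ.toLin x ∈ T.coboundaries n → x ∈ S.coboundaries n) ∧
    (∀ y ∈ T.cocycles n, ∃ x ∈ S.cocycles n, φ.toLin x - y ∈ T.coboundaries n)

/-- A morphism of CDGAs is an isomorphism if it is bijective and identifies the
gradings. -/
def IsIso {S T : CDGA} (φ : CDGAHom S T) : Prop :=
  Function.Bijective φ.toLin ∧ ∀ n, (S.grading n).map φ.toLin = T.grading n

end CDGAHom

/-- There is a direct quasi-isomorphism between two CDGAs. -/
def DirectQIso (S T : CDGA) : Prop := ∃ φ : CDGAHom S T, φ.IsQuasiIso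

/-- Two CDGAs are quasi-isomorphic if they are connected by a zigzag of
quasi-isomorphisms. -/
def QIso : CDGA → CDGA → Prop := Relation.EqvGen DirectQIso

/-! ## Cohomology of a CDGA and induced maps -/

namespace CDGA

/-- Coboundaries viewed inside the `n`-cocycles. -/
def Hsub (S : CDGA) (n : ℕ) : Submodule ℝ ↥(S.cocycles n) :=
  (S.coboundaries n).comap (S.cocycles n).subtype

/-- The degree `n` cohomology of a CDGA. -/
abbrev H (S : CDGA) (n : ℕ) := ↥(S.cocycles n) ⧸ S.Hsub n

end CDGA

namespace CDGAHom

/-- The map induced on cocycles by a CDGA morphism. -/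
def cocyclesMap {S T : CDGA} (φ : CDGAHom S T) (n : ℕ) :
    ↥(S.cocycles n) →ₗ[ℝ] ↥(T.cocycles n) :=
  φ.toLin.restrict (p := S.cocycles n) (q := T.cocycles n) (fun x hx => by
    obtain ⟨h1, h2⟩ := Submodule.mem_inf.mp hx
    refine Submodule.mem_inf.mpr ⟨?_, φ.map_grading h2⟩
    rw [LinearMap.mem_ker] at h1 ⊢
    rw [← φ.map_d, h1, map_zero])

/-- The map induced in cohomology by a CDGA morphism. -/
def Hmap {S T : CDGA} (φ : CDGAHom S T) (n : ℕ) : S.H n →ₗ[ℝ] T.H n :=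
  Submodule.mapQ (S.Hsub n) (T.Hsub n) (φ.cocyclesMap n) (by
    intro x hx
    simp only [CDGA.Hsub, Submodule.mem_comap, Submodule.subtype_apply] at hx ⊢
    have hco : φ.toLin (x : S.carrier) ∈ T.coboundaries n := by
      cases n with
      | zero =>
          simp only [CDGA.coboundaries, Submodule.mem_bot] at hx ⊢
          rw [hx, map_zero]
      | succ n =>
          simp only [CDGA.coboundaries, Submodule.mem_map] at hx ⊢
          obtain ⟨b, hb, hdb⟩ := hx
          exact ⟨φ.toLin b, φ.map_grading hb, by rw [← φ.map_d, hdb]⟩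
    exact hco)

end CDGAHom

/-- `ZigzagInduces S T γ` holds when the CDGAs `S` and `T` are connected by a chain of
quasi-isomorphisms whose induced isomorphism in cohomology is `γ`. -/
inductive ZigzagInduces : ∀ (S T : CDGA), (∀ n, S.H n →ₗ[ℝ] T.H n) → Prop
  | direct {S T : CDGA} (φ : CDGAHom S T) (hφ : φ.IsQuasiIso) : ZigzagInduces S T φ.Hmap
  | symm {S T : CDGA} (γ : ∀ n, S.H n →ₗ[ℝ] T.H n) (γ' : ∀ n, T.H n →ₗ[ℝ] S.H n)
      (h : ZigzagInduces S T γ) (hl : ∀ n x, γ' n (γ n x) = x)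
      (hr : ∀ n y, γ n (γ' n y) = y) : ZigzagInduces T S γ'
  | trans {S T U : CDGA} (γ₁ : ∀ n, S.H n →ₗ[ℝ] T.H n) (γ₂ : ∀ n, T.H n →ₗ[ℝ] U.H n)
      (h₁ : ZigzagInduces S T γ₁) (h₂ : ZigzagInduces T U γ₂) :
      ZigzagInduces S U (fun n => (γ₂ n).comp (γ₁ n))

/-! ## Hirsch extensions -/

/-- `IsHirschExt1 A z E` : `E` is (a model of) the Hirsch extension
`(A ⊗ ∧⟨y⟩, dy = z)` of `A` by one generator `y` of degree 1, characterized by its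
universal property. -/
structure IsHirschExt1 (A : CDGA) (z : A.carrier) (E : CDGA) where
  incl : CDGAHom A E
  y : E.carrier
  y_mem : y ∈ E.grading 1
  dy : E.d y = incl.toLin z
  universal : ∀ (C : CDGA) (ψ : CDGAHom A C) (k : C.carrier),
    k ∈ C.grading 1 → C.d k = ψ.toLin z →
    ∃! Φ : CDGAHom E C, (∀ a, Φ.toLin (incl.toLin a) = ψ.toLin a) ∧ Φ.toLin y = k

/-- `IsHirschExt2 A z E` : `E` is (a model of) the Hirsch extension
`(A ⊗ ∧⟨x, y⟩, dx = 0, dy = z)` of `A` by two generators of degree 1. -/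
structure IsHirschExt2 (A : CDGA) (z : A.carrier) (E : CDGA) where
  incl : CDGAHom A E
  x : E.carrier
  y : E.carrier
  x_mem : x ∈ E.grading 1
  y_mem : y ∈ E.grading 1
  dx : E.d x = 0
  dy : E.d y = incl.toLin z
  universal : ∀ (C : CDGA) (ψ : CDGAHom A C) (kx ky : C.carrier),
    kx ∈ C.grading 1 → ky ∈ C.grading 1 → C.d kx = 0 → C.d ky = ψ.toLin z →
    ∃! Φ : CDGAHom E C, (∀ a, Φ.toLin (incl.toLin a) = ψ.toLin a) ∧
      Φ.toLin x = kx ∧ Φ.toLin y = ky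

/-- `IsHirschExtDeg1 A V f E` : `E` is (a model of) the Hirsch extension
`(A ⊗ ∧V, d_f)` of `A` by the vector space `V` concentrated in degree 1, along the
linear map `f : V → A₂`. -/
structure IsHirschExtDeg1 (A : CDGA) (V : Type) [AddCommGroup V] [Module ℝ V]
    (f : V →ₗ[ℝ] A.carrier) (E : CDGA) where
  incl : CDGAHom A E
  j : V →ₗ[ℝ] E.carrier
  j_mem : ∀ v, j v ∈ E.grading 1
  dj : ∀ v, E.d (j v) = incl.toLin (f v)
  universal : ∀ (C : CDGA) (ψ : CDGAHom A C) (k : V →ₗ[ℝ] C.carrier),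
    (∀ v, k v ∈ C.grading 1) → (∀ v, C.d (k v) = ψ.toLin (f v)) →
    ∃! Φ : CDGAHom E C, (∀ a, Φ.toLin (incl.toLin a) = ψ.toLin a) ∧
      ∀ v, Φ.toLin (j v) = k v

/-- A graded vector space over ℝ. -/
structure GradedVS where
  V : ℕ → Type
  [acg : ∀ n, AddCommGroup (V n)]
  [mod : ∀ n, Module ℝ (V n)]

attribute [instance] GradedVS.acg GradedVS.mod

/-- A `V`-CDGA structure on the CDGA `A`: a degree 1 linear map `f : V → A` with
`d ∘ f = 0`. -/
structure VStr (W : GradedVS) (A : CDGA) where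
  f : ∀ n, W.V n →ₗ[ℝ] A.carrier
  f_mem : ∀ n v, f n v ∈ A.grading (n + 1)
  f_closed : ∀ n v, A.d (f n v) = 0

/-- The map `f^♯ : V → H^{*+1}(A)` induced by a `V`-CDGA structure. -/
def VStr.fsharp {W : GradedVS} {A : CDGA} (F : VStr W A) (n : ℕ) (v : W.V n) :
    A.H (n + 1) :=
  Submodule.Quotient.mk ⟨F.f n v, Submodule.mem_inf.mpr
    ⟨LinearMap.mem_ker.mpr (F.f_closed n v), F.f_mem n v⟩⟩

/-- `IsHirschExt W F E` : `E` is (a model of) the Hirsch extension `(A ⊗ ∧V, d_f)`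
of `A` along the `V`-CDGA structure `F`, characterized by its universal property. -/
structure IsHirschExt (W : GradedVS) {A : CDGA} (F : VStr W A) (E : CDGA) where
  incl : CDGAHom A E
  j : ∀ n, W.V n →ₗ[ℝ] E.carrier
  j_mem : ∀ n v, j n v ∈ E.grading n
  dj : ∀ n v, E.d (j n v) = incl.toLin (F.f n v)
  universal : ∀ (C : CDGA) (ψ : CDGAHom A C) (k : ∀ n, W.V n →ₗ[ℝ] C.carrier),
    (∀ n v, k n v ∈ C.grading n) → (∀ n v, C.d (k n v) = ψ.toLin (F.f n v)) →
    ∃! Φ : CDGAHom E C, (∀ a, Φ.toLin (incl.toLin a) = ψ.toLin a) ∧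
      ∀ n v, Φ.toLin (j n v) = k n v

/-- A CDGA is almost formal of index `l` if it is quasi-isomorphic to a Hirsch
extension `(A ⊗ ∧⟨y⟩, dy = z)` where `A` is a connected CDGA with zero differential
and `z ∈ A₂` satisfies `z^l ≠ 0`, `z^(l+1) = 0`. -/
def AlmostFormalOfIndex (S : CDGA) (l : ℕ) : Prop :=
  ∃ (A : CDGA) (z : A.carrier) (E : CDGA),
    A.Connected ∧ A.d = 0 ∧ z ∈ A.grading 2 ∧ z ^ l ≠ 0 ∧ z ^ (l + 1) = 0 ∧
    Nonempty (IsHirschExt1 A z E) ∧ QIso S E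

/-- `IsCohomologyAlgebraOf S P HB` : the CDGA `HB` (with zero differential) is the
cohomology algebra of the subcomplex `P` of `S`, via the projections `pr n` sending
a cocycle of the subcomplex to its cohomology class. -/
structure IsCohomologyAlgebraOf (S : CDGA) (P : ℕ → Submodule ℝ S.carrier)
    (HB : CDGA) where
  zero_d : HB.d = 0
  pr : ∀ n, ↥(P n ⊓ LinearMap.ker S.d) →ₗ[ℝ] HB.carrier
  pr_mem : ∀ n x, pr n x ∈ HB.grading n
  pr_surj : ∀ n, ∀ h ∈ HB.grading n, ∃ x, pr n x = h
  pr_ker : ∀ n x, pr n x = 0 ↔ (x : S.carrier) ∈ subBound S P n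
  pr_one : ∀ (h : (1 : S.carrier) ∈ P 0 ⊓ LinearMap.ker S.d), pr 0 ⟨1, h⟩ = 1
  pr_mul : ∀ (m n : ℕ) (x : ↥(P m ⊓ LinearMap.ker S.d)) (y : ↥(P n ⊓ LinearMap.ker S.d))
      (h : ((x : S.carrier) * (y : S.carrier)) ∈ P (m + n) ⊓ LinearMap.ker S.d),
      pr (m + n) ⟨(x : S.carrier) * (y : S.carrier), h⟩ = pr m x * pr n y

/-! ## Operations of a Lie algebra in a CDGA -/

/-- The coadjoint action of a Lie algebra on its dual. -/
def coAd {L : Type} [LieRing L] [LieAlgebra ℝ L] (a : L) (α : Module.Dual ℝ L) :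
    Module.Dual ℝ L where
  toFun b := - α ⁅a, b⁆
  map_add' x y := by simp [lie_add]; ring
  map_smul' c x := by simp [lie_smul]

/-- An operation of a Lie algebra `L` in a CDGA `S`: a linear family of degree `-1`
derivations `i x` such that, with `𝓛 x := [i x, d] = i x ∘ d + d ∘ i x`, the usual
identities of Cartan calculus hold. -/
structure Operation (L : Type) [LieRing L] [LieAlgebra ℝ L] (S : CDGA) where
  i : L →ₗ[ℝ] S.carrier →ₗ[ℝ] S.carrier
  i_mem : ∀ (x : L) {n : ℕ} {a : S.carrier}, a ∈ S.grading (n + 1) → i x a ∈ S.grading n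
  i_zero : ∀ (x : L) {a : S.carrier}, a ∈ S.grading 0 → i x a = 0
  i_antider : ∀ (x : L) {m : ℕ} {a : S.carrier}, a ∈ S.grading m → ∀ b,
      i x (a * b) = i x a * b + ((-1 : ℝ) ^ m) • (a * i x b)
  i_sq : ∀ (x : L) (a : S.carrier), i x (i x a) = 0
  lie_lie : ∀ (x y : L) (a : S.carrier),
      (i ⁅x, y⁆ (S.d a) + S.d (i ⁅x, y⁆ a)) =
        (i x (S.d (i y (S.d a) + S.d (i y a))) + S.d (i x (i y (S.d a) + S.d (i y a)))) -
        (i y (S.d (i x (S.d a) + S.d (i x a))) + S.d (i y (i x (S.d a) + S.d (i x a))))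
  i_lie : ∀ (x y : L) (a : S.carrier),
      i ⁅x, y⁆ a = (i x (S.d (i y a)) + S.d (i x (i y a))) - i y (i x (S.d a) + S.d (i x a))

namespace Operation

variable {L : Type} [LieRing L] [LieAlgebra ℝ L] {S : CDGA}

/-- The Lie derivative `𝓛 x = [i x, d]` associated to an operation. -/
def lieD (op : Operation L S) (x : L) : S.carrier →ₗ[ℝ] S.carrier :=
  S.d ∘ₗ op.i x + op.i x ∘ₗ S.d

/-- Elements killed by all the `i x`. -/
def iKer (op : Operation L S) : Submodule ℝ S.carrier :=
  ⨅ x : L, LinearMap.ker (op.i x)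

/-- Elements killed by all the Lie derivatives `𝓛 x`. -/
def lieKer (op : Operation L S) : Submodule ℝ S.carrier :=
  ⨅ x : L, LinearMap.ker (op.lieD x)

end Operation

/-- A degree `-1` derivation of a CDGA. -/
structure DerNeg1 (S : CDGA) where
  D : S.carrier →ₗ[ℝ] S.carrier
  mem : ∀ {n : ℕ} {a : S.carrier}, a ∈ S.grading (n + 1) → D a ∈ S.grading n
  zero : ∀ {a : S.carrier}, a ∈ S.grading 0 → D a = 0
  antider : ∀ {m : ℕ} {a : S.carrier}, a ∈ S.grading m → ∀ b,
      D (a * b) = D a * b + ((-1 : ℝ) ^ m) • (a * D b)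

/-- An algebraic connection for an operation of an (abelian) Lie algebra in a CDGA. -/
structure AlgConnection {L : Type} [LieRing L] [LieAlgebra ℝ L] {S : CDGA}
    (op : Operation L S) where
  χ : Module.Dual ℝ L →ₗ[ℝ] S.carrier
  mem : ∀ α, χ α ∈ S.grading 1
  horizontal : ∀ (a : L) (α), op.i a (χ α) = α a • (1 : S.carrier)
  equivariant : ∀ (a : L) (α),
    op.i a (S.d (χ α)) + S.d (op.i a (χ α)) = χ (coAd a α)

/-! ## An axiomatization of the Cartan calculus of a smooth manifold -/

/-- `CartanCalc M` packages the de Rham algebra `Ω`, the Lie algebra of smooth vector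
fields `X`, interior products, the module structure of functions on vector fields
and the evaluation of functions at points, together with the usual identities of
Cartan calculus, for a smooth manifold with underlying space `M` of dimension
`dim`. -/
structure CartanCalc (M : Type) [TopologicalSpace M] where
  dim : ℕ
  Ω : CDGA
  grading_top : ∀ n, dim < n → Ω.grading n = ⊥
  X : Type
  [xlie : LieRing X]
  [xlalg : LieAlgebra ℝ X]
  smul0 : Ω.carrier →ₗ[ℝ] X →ₗ[ℝ] X
  smul0_one : ∀ v, smul0 1 v = v
  smul0_mul : ∀ (f g : Ω.carrier), f ∈ Ω.grading 0 → g ∈ Ω.grading 0 →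
      ∀ v, smul0 (f * g) v = smul0 f (smul0 g v)
  iprod : X →ₗ[ℝ] Ω.carrier →ₗ[ℝ] Ω.carrier
  iprod_mem : ∀ (v : X) {n : ℕ} {a : Ω.carrier},
      a ∈ Ω.grading (n + 1) → iprod v a ∈ Ω.grading n
  iprod_zero : ∀ (v : X) {a : Ω.carrier}, a ∈ Ω.grading 0 → iprod v a = 0
  iprod_antider : ∀ (v : X) {m : ℕ} {a : Ω.carrier}, a ∈ Ω.grading m → ∀ b,
      iprod v (a * b) = iprod v a * b + ((-1 : ℝ) ^ m) • (a * iprod v b)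
  iprod_sq : ∀ (v : X) (a : Ω.carrier), iprod v (iprod v a) = 0
  iprod_smul0 : ∀ (f : Ω.carrier) (v : X) (a : Ω.carrier), f ∈ Ω.grading 0 →
      iprod (smul0 f v) a = f * iprod v a
  iprod_bracket : ∀ (v w : X) (a : Ω.carrier),
      iprod ⁅v, w⁆ a =
        (iprod v (Ω.d (iprod w a)) + Ω.d (iprod v (iprod w a))) -
          iprod w (iprod v (Ω.d a) + Ω.d (iprod v a))
  ev : Ω.carrier →ₗ[ℝ] (M → ℝ)
  ev_one : ev 1 = fun _ => 1
  ev_mul : ∀ {a b : Ω.carrier}, a ∈ Ω.grading 0 → b ∈ Ω.grading 0 →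
      ev (a * b) = ev a * ev b
  ev_inj : ∀ {a : Ω.carrier}, a ∈ Ω.grading 0 → ev a = 0 → a = 0

attribute [instance] CartanCalc.xlie CartanCalc.xlalg

namespace CartanCalc

variable {M : Type} [TopologicalSpace M]

/-- The Lie derivative along a vector field, via Cartan's magic formula. -/
def lieD (C : CartanCalc M) (v : C.X) : C.Ω.carrier →ₗ[ℝ] C.Ω.carrier :=
  C.Ω.d ∘ₗ C.iprod v + C.iprod v ∘ₗ C.Ω.d

/-- A vector field vanishes at a point if it kills all functions there. -/
def VanishesAt (C : CartanCalc M) (v : C.X) (p : M) : Prop :=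
  ∀ f ∈ C.Ω.grading 0, C.ev (C.lieD v f) p = 0

/-- The basic subcomplex determined by a family `vs` of vector fields:
forms killed by all interior products and Lie derivatives along members of `vs`. -/
def basicSub (C : CartanCalc M) (vs : Set C.X) (n : ℕ) : Submodule ℝ C.Ω.carrier :=
  C.Ω.grading n ⊓ (⨅ v ∈ vs, LinearMap.ker (C.iprod v)) ⊓
    ⨅ v ∈ vs, LinearMap.ker (C.lieD v)

/-- The invariant subcomplex determined by a family `vs` of vector fields:
forms killed by all Lie derivatives along members of `vs`. -/
def invSub (C : CartanCalc M) (vs : Set C.X) (n : ℕ) : Submodule ℝ C.Ω.carrier :=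
  C.Ω.grading n ⊓ ⨅ v ∈ vs, LinearMap.ker (C.lieD v)

end CartanCalc

/-- A Riemannian metric, in the axiomatized Cartan calculus. -/
structure RMetric {M : Type} [TopologicalSpace M] (C : CartanCalc M) where
  g : C.X →ₗ[ℝ] C.X →ₗ[ℝ] C.Ω.carrier
  g_mem : ∀ v w, g v w ∈ C.Ω.grading 0
  g_symm : ∀ v w, g v w = g w v
  g_smul0 : ∀ (f : C.Ω.carrier) (v w : C.X), f ∈ C.Ω.grading 0 →
      g (C.smul0 f v) w = f * g v w
  g_pos : ∀ (v : C.X) (p : M), ¬ C.VanishesAt v p → 0 < C.ev (g v v) p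
  g_nondeg : ∀ v, (∀ w, g v w = 0) → v = 0

/-- A vector field is Killing if the Lie derivative of the metric along it vanishes. -/
def RMetric.IsKilling {M : Type} [TopologicalSpace M] {C : CartanCalc M}
    (gm : RMetric C) (v : C.X) : Prop :=
  ∀ w z : C.X, C.lieD v (gm.g w z) = gm.g ⁅v, w⁆ z + gm.g w ⁅v, z⁆

/-! ## Almost contact metric structures -/

/-- An almost contact metric structure `(φ, ξ, η, h)` together with its fundamental
2-form `Φ₂`. -/
structure AlmostContactMetric {M : Type} [TopologicalSpace M] (C : CartanCalc M) where
  gm : RMetric C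
  φ : C.X →ₗ[ℝ] C.X
  ξ : C.X
  η : C.Ω.carrier
  η_mem : η ∈ C.Ω.grading 1
  φ_sq : ∀ v, φ (φ v) = -v + C.smul0 (C.iprod v η) ξ
  η_ξ : C.iprod ξ η = 1
  η_dual : ∀ v, C.iprod v η = gm.g v ξ
  compat : ∀ v w, gm.g (φ v) (φ w) = gm.g v w - C.iprod v η * C.iprod w η
  Φ2 : C.Ω.carrier
  Φ2_mem : Φ2 ∈ C.Ω.grading 2
  Φ2_eval : ∀ v w, C.iprod w (C.iprod v Φ2) = gm.g v (φ w)

namespace AlmostContactMetric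

variable {M : Type} [TopologicalSpace M] {C : CartanCalc M}

/-- Normality: `N_φ + dη ⊗ ξ = 0`. -/
def Normal (s : AlmostContactMetric C) : Prop :=
  ∀ v w : C.X,
    s.φ (s.φ ⁅v, w⁆) + ⁅s.φ v, s.φ w⁆ - s.φ ⁅s.φ v, w⁆ - s.φ ⁅v, s.φ w⁆
      + C.smul0 (C.iprod w (C.iprod v (C.Ω.d s.η))) s.ξ = 0

/-- Quasi-Sasakian: normal and with closed fundamental 2-form. -/
def QuasiSasakian (s : AlmostContactMetric C) : Prop :=
  s.Normal ∧ C.Ω.d s.Φ2 = 0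

/-- Sasakian: normal and `dη = Φ`. -/
def Sasakian (s : AlmostContactMetric C) : Prop :=
  s.Normal ∧ C.Ω.d s.η = s.Φ2

end AlmostContactMetric

/-- The index of a quasi-Sasakian structure: the natural number `l` with
`[dη]_B^l ≠ 0` and `[dη]_B^{l+1} = 0` in the basic cohomology of the foliation
generated by the Reeb vector field. -/
def QSIndex {M : Type} [TopologicalSpace M] {C : CartanCalc M}
    (s : AlmostContactMetric C) (l : ℕ) : Prop :=
  (C.Ω.d s.η) ^ l ∉ subBound C.Ω (C.basicSub {s.ξ}) (2 * l) ∧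
    (C.Ω.d s.η) ^ (l + 1) ∈ subBound C.Ω (C.basicSub {s.ξ}) (2 * l + 2)

/-! ## Hermitian, quasi-Vaisman and Vaisman structures -/

/-- A Hermitian structure `(J, g)` with its fundamental 2-form `Ω₂`. -/
structure HermitianStr {M : Type} [TopologicalSpace M] (C : CartanCalc M) where
  gm : RMetric C
  J : C.X →ₗ[ℝ] C.X
  J_sq : ∀ v, J (J v) = -v
  compat : ∀ v w, gm.g (J v) (J w) = gm.g v w
  integrable : ∀ v w, ⁅J v, J w⁆ - J ⁅J v, w⁆ - J ⁅v, J w⁆ - ⁅v, w⁆ = 0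
  Ω2 : C.Ω.carrier
  Ω2_mem : Ω2 ∈ C.Ω.grading 2
  Ω2_eval : ∀ v w, C.iprod w (C.iprod v Ω2) = gm.g v (J w)

/-- A quasi-Vaisman structure: a Hermitian structure `(J, g)` together with a closed
1-form `θ` whose metric dual `U` is unitary, Killing and holomorphic, such that
`dΩ = dη ∧ θ` where `η = -θ ∘ J`; `V` is the metric dual of `η`. -/
structure QuasiVaismanStr {M : Type} [TopologicalSpace M] (C : CartanCalc M) where
  herm : HermitianStr C
  θ : C.Ω.carrier
  θ_mem : θ ∈ C.Ω.grading 1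
  θ_closed : C.Ω.d θ = 0
  U : C.X
  U_dual : ∀ w, C.iprod w θ = herm.gm.g U w
  U_unit : herm.gm.g U U = 1
  U_killing : herm.gm.IsKilling U
  U_hol : ∀ w, ⁅U, herm.J w⁆ = herm.J ⁅U, w⁆
  η : C.Ω.carrier
  η_mem : η ∈ C.Ω.grading 1
  η_eval : ∀ w, C.iprod w η = - C.iprod (herm.J w) θ
  V : C.X
  V_dual : ∀ w, C.iprod w η = herm.gm.g V w
  dΩ_eq : C.Ω.d herm.Ω2 = C.Ω.d η * θ

/-- A Vaisman structure: a locally conformal Kähler structure (`dΩ = Ω ∧ θ` with `θ`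
closed) whose Lee form `θ` is parallel; since `θ` is closed and of constant unit
norm, parallelism of `θ` is equivalent to its metric dual `U` being Killing. -/
structure VaismanStr {M : Type} [TopologicalSpace M] (C : CartanCalc M) where
  herm : HermitianStr C
  θ : C.Ω.carrier
  θ_mem : θ ∈ C.Ω.grading 1
  θ_closed : C.Ω.d θ = 0
  lck : C.Ω.d herm.Ω2 = herm.Ω2 * θ
  U : C.X
  U_dual : ∀ w, C.iprod w θ = herm.gm.g U w
  U_unit : herm.gm.g U U = 1
  U_killing : herm.gm.IsKilling U

/-- The index of a quasi-Vaisman structure. -/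
def QVIndex {M : Type} [TopologicalSpace M] {C : CartanCalc M}
    (s : QuasiVaismanStr C) (l : ℕ) : Prop :=
  (C.Ω.d s.η) ^ l ∉ subBound C.Ω (C.basicSub {s.U, s.V}) (2 * l) ∧
    (C.Ω.d s.η) ^ (l + 1) ∈ subBound C.Ω (C.basicSub {s.U, s.V}) (2 * l + 2)

/-- The data relating the Cartan calculus of `M` to the Cartan calculus of the
product of `M` with a line (or a circle): the lift of vector fields, the pullback of
forms, the canonical vector field `E = ∂/∂t` of the second factor and its dual
closed 1-form `dt`. -/
structure ProductWithLine {M M' : Type} [TopologicalSpace M] [TopologicalSpace M']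
    (C : CartanCalc M) (C' : CartanCalc M') where
  liftX : C.X →ₗ[ℝ] C'.X
  liftΩ : CDGAHom C.Ω C'.Ω
  E : C'.X
  dt : C'.Ω.carrier
  dt_mem : dt ∈ C'.Ω.grading 1
  dt_closed : C'.Ω.d dt = 0
  iE_dt : C'.iprod E dt = 1
  iX_dt : ∀ v, C'.iprod (liftX v) dt = 0
  bracket_lift : ∀ v w, ⁅liftX v, liftX w⁆ = liftX ⁅v, w⁆
  bracket_E : ∀ v, ⁅E, liftX v⁆ = 0
  i_lift : ∀ v a, C'.iprod (liftX v) (liftΩ.toLin a) = liftΩ.toLin (C.iprod v a)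
  iE_lift : ∀ a, C'.iprod E (liftΩ.toLin a) = 0

/-! ## The generalized Heisenberg groups -/

/-- The generalized Heisenberg group `H(1, l)` of upper unitriangular matrices with
top row `p ∈ ℝ^l`, last column `q ∈ ℝ^l` and corner entry `t`. -/
@[ext]
structure Heisenberg (l : ℕ) where
  p : Fin l → ℝ
  q : Fin l → ℝ
  t : ℝ

namespace Heisenberg

variable {l : ℕ}

instance : Mul (Heisenberg l) :=
  ⟨fun a b => ⟨a.p + b.p, a.q + b.q, a.t + b.t + ∑ i, a.p i * b.q i⟩⟩

instance : One (Heisenberg l) := ⟨⟨0, 0, 0⟩⟩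

instance : Inv (Heisenberg l) :=
  ⟨fun a => ⟨-a.p, -a.q, -a.t + ∑ i, a.p i * a.q i⟩⟩

@[simp] theorem mul_p (a b : Heisenberg l) : (a * b).p = a.p + b.p := rfl
@[simp] theorem mul_q (a b : Heisenberg l) : (a * b).q = a.q + b.q := rfl
@[simp] theorem mul_t (a b : Heisenberg l) :
    (a * b).t = a.t + b.t + ∑ i, a.p i * b.q i := rfl
@[simp] theorem one_p : (1 : Heisenberg l).p = 0 := rfl
@[simp] theorem one_q : (1 : Heisenberg l).q = 0 := rfl
@[simp] theorem one_t : (1 : Heisenberg l).t = 0 := rfl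
@[simp] theorem inv_p (a : Heisenberg l) : a⁻¹.p = -a.p := rfl
@[simp] theorem inv_q (a : Heisenberg l) : a⁻¹.q = -a.q := rfl
@[simp] theorem inv_t (a : Heisenberg l) :
    a⁻¹.t = -a.t + ∑ i, a.p i * a.q i := rfl

instance : Group (Heisenberg l) where
  mul_assoc a b c := by
    ext
    · simp [add_assoc]
    · simp [add_assoc]
    · simp only [mul_t, mul_p, mul_q, Pi.add_apply, add_mul, mul_add,
        Finset.sum_add_distrib]
      ring
  one_mul a := by ext <;> simp
  mul_one a := by ext <;> simp
  inv_mul_cancel a := by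
    ext
    · simp
    · simp
    · simp only [mul_t, inv_t, inv_p, Pi.neg_apply, neg_mul, one_t,
        Finset.sum_neg_distrib]
      ring

instance : TopologicalSpace (Heisenberg l) :=
  TopologicalSpace.induced (fun a => (a.p, a.q, a.t)) inferInstance

end Heisenberg

/-- Two topological groups are isomorphic as Lie groups (for 1-connected Lie groups
a continuous group isomorphism is automatically an isomorphism of Lie groups). -/
def IsoAsLieGroups (G H : Type) [Group G] [Group H] [TopologicalSpace G]
    [TopologicalSpace H] : Prop :=
  ∃ e : G ≃* H, Continuous e ∧ Continuous e.symm


section HirschProof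

open TensorProduct DirectSum

/-- Total space of a graded vector space. -/
abbrev GradedVS.tot (W : GradedVS) : Type := ⨁ n, W.V n

abbrev GradedVS.Ext (W : GradedVS) : Type := ExteriorAlgebra ℝ W.tot

/-- An algebra model of `A ⊗ ∧V` (no differential). -/
structure HMdl (W : GradedVS) (A : CDGA) where
  E : Type
  [ring : Ring E]
  [algebra : Algebra ℝ E]
  incl : A.carrier →ₐ[ℝ] E
  e : W.Ext →ₐ[ℝ] E
  bij : Function.Bijective
    (TensorProduct.lift ((LinearMap.mul ℝ E).compl₁₂ incl.toLinearMap e.toLinearMap))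
  comm : ∀ (n : ℕ) (a : A.carrier) (m : W.tot), a ∈ A.grading n →
    incl a * e (ExteriorAlgebra.ι ℝ m) = ((-1 : ℝ) ^ n) • (e (ExteriorAlgebra.ι ℝ m) * incl a)
  lift : ∀ (C : Type) [Ring C] [Algebra ℝ C] (α : A.carrier →ₐ[ℝ] C) (β : W.tot →ₗ[ℝ] C),
    (∀ m, β m * β m = 0) →
    (∀ (n : ℕ) (a : A.carrier) (m : W.tot), a ∈ A.grading n →
      α a * β m = ((-1 : ℝ) ^ n) • (β m * α a)) →
    ∃ Ψ : E →ₐ[ℝ] C, (∀ a, Ψ (incl a) = α a) ∧ ∀ m, Ψ (e (ExteriorAlgebra.ι ℝ m)) = β m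

attribute [instance] HMdl.ring HMdl.algebra

/-- The graded algebra structure on a CDGA. -/
@[reducible] def CDGA.ga (A : CDGA) : GradedAlgebra A.grading :=
  { A.internal.chooseDecomposition with
    one_mem := A.one_mem
    mul_mem := fun _ _ _ _ ha hb => A.mul_mem ha hb }

lemma anti_aux {C : Type} [Ring C] [Algebra ℝ C] {n : ℕ} (W : GradedVS) (x : C)
    (g : W.Ext →ₐ[ℝ] C)
    (h : ∀ m, x * g (ExteriorAlgebra.ι ℝ m) = ((-1 : ℝ) ^ n) • (g (ExteriorAlgebra.ι ℝ m) * x))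
    (j : ℕ) (b : W.Ext) (hb : b ∈ (⋀[ℝ]^j W.tot)) :
    x * g b = ((-1 : ℝ) ^ (j * n)) • (g b * x) := by
  induction hb using Submodule.pow_induction_on_left' with
  | algebraMap r => simp [Algebra.algebraMap_eq_smul_one]
  | add _ _ _ _ _ ihx ihy => rw [map_add, mul_add, ihx, ihy, add_mul, smul_add]
  | mem_mul m hm i y _ ih =>
      obtain ⟨m, rfl⟩ := hm
      rw [map_mul, ← mul_assoc, h, smul_mul_assoc, mul_assoc, ih, mul_smul_comm, smul_smul,
        ← mul_assoc]
      congr 1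
      rw [Nat.succ_eq_add_one, add_mul, one_mul, pow_add, mul_comm]

theorem HMdl.exists (W : GradedVS) (A : CDGA) : Nonempty (HMdl W A) := by
  let := A.ga
  let ℬ : ℕ → Submodule ℝ W.Ext := fun i => ⋀[ℝ]^i W.tot
  let : GradedAlgebra ℬ := ExteriorAlgebra.gradedAlgebra ℝ W.tot
  refine ⟨{ E := GradedTensorProduct ℝ A.grading ℬ
            incl := GradedTensorProduct.includeLeft A.grading ℬ
            e := GradedTensorProduct.includeRight A.grading ℬ
            bij := ?_
            comm := ?_
            lift := ?_ }⟩
  · have : (TensorProduct.lift ((LinearMap.mul ℝ (GradedTensorProduct ℝ A.grading ℬ)).compl₁₂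
      (GradedTensorProduct.includeLeft A.grading ℬ).toLinearMap
      (GradedTensorProduct.includeRight A.grading ℬ).toLinearMap)) =
        (GradedTensorProduct.of ℝ A.grading ℬ).toLinearMap := by
      ext a b
      simp [GradedTensorProduct.tmul_one_mul_one_tmul A.grading ℬ]
    rw [this]
    exact (GradedTensorProduct.of ℝ A.grading ℬ).bijective
  · intro n a m ha
    have h1 : (ExteriorAlgebra.ι ℝ m : W.Ext) ∈ ℬ 1 := by
      simpa only [ℬ, pow_one] using LinearMap.mem_range_self _ m
    have := GradedTensorProduct.tmul_coe_mul_coe_tmul (R := ℝ) A.grading ℬ 1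
      (⟨_, h1⟩ : ℬ 1) (⟨a, ha⟩ : A.grading n) 1
    simp only [GradedTensorProduct.includeLeft_apply, GradedTensorProduct.includeRight_apply] at this ⊢
    rw [this]
    rcases Nat.even_or_odd n with hn | hn <;> simp [hn.neg_one_pow, Units.smul_def,
      GradedTensorProduct.tmul_one_mul_one_tmul A.grading ℬ]
  · intro C _ _ α β hβ hαβ
    refine ⟨GradedTensorProduct.lift A.grading ℬ α (ExteriorAlgebra.lift ℝ ⟨β, hβ⟩) ?_, ?_, ?_⟩
    · intro i j a b
      rw [anti_aux (n := i) W (α a) (ExteriorAlgebra.lift ℝ ⟨β, hβ⟩)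
        (fun m => by simpa using hαβ i a m a.2) j b b.2]
      rcases Nat.even_or_odd (j * i) with hn | hn <;> simp [hn.neg_one_pow, Units.smul_def]
    · intro a
      simp
    · intro m
      simp

/-- Algebra maps out of a CDGA, constructed degree by degree. -/
theorem CDGA.exists_algHom (A : CDGA) {C : Type} [Ring C] [Algebra ℝ C]
    (f : ∀ n, A.carrier →ₗ[ℝ] C) (h1 : f 0 1 = 1)
    (hm : ∀ m n a b, a ∈ A.grading m → b ∈ A.grading n → f (m + n) (a * b) = f m a * f n b) :
    ∃ α : A.carrier →ₐ[ℝ] C, ∀ n a, a ∈ A.grading n → α a = f n a := by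
  let := A.ga
  let f' : ∀ i, A.grading i →ₗ[ℝ] C := fun i => (f i).comp (A.grading i).subtype
  have ho : f' 0 (GradedMonoid.GOne.one (A := fun i => A.grading i)) = 1 := by simpa [f'] using h1
  have hmm : ∀ {i j} (ai : A.grading i) (aj : A.grading j),
      f' _ (GradedMonoid.GMul.mul (A := fun i => A.grading i) ai aj) = f' _ ai * f' _ aj := by
    intro i j ai aj; simpa [f'] using hm i j ai aj ai.2 aj.2
  let g := DirectSum.toAlgebra ℝ (fun i => A.grading i) (B := C) f' ho hmm
  refine ⟨g.comp (DirectSum.decomposeAlgEquiv A.grading).toAlgHom, ?_⟩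
  intro n a ha
  have : g (DirectSum.of (fun i => A.grading i) n ⟨a, ha⟩) = f n a :=
    DirectSum.toSemiring_of (fun i => (f' i).toAddMonoidHom) ho hmm n _
  simpa [DirectSum.decompose_of_mem A.grading ha] using this

theorem CDGA.iSup_grading (A : CDGA) : ⨆ n, A.grading n = ⊤ :=
  A.internal.submodule_iSup_eq_top

theorem CDGA.lin_ext (A : CDGA) {M : Type} [AddCommGroup M] [Module ℝ M]
    {f g : A.carrier →ₗ[ℝ] M} (h : ∀ n, ∀ a ∈ A.grading n, f a = g a) : f = g := by
  have : (⊤ : Submodule ℝ A.carrier) ≤ LinearMap.eqLocus f g := by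
    rw [← A.iSup_grading]
    exact iSup_le fun n a ha => h n a ha
  exact LinearMap.ext fun a => this (Submodule.mem_top : a ∈ ⊤)

theorem CDGAHom.ext' {S T : CDGA} {φ ψ : CDGAHom S T} (h : φ.toLin = ψ.toLin) : φ = ψ := by
  cases φ; cases ψ; cases h; rfl

/-- The underlying algebra morphism. -/
def CDGAHom.alg {S T : CDGA} (φ : CDGAHom S T) : S.carrier →ₐ[ℝ] T.carrier :=
  AlgHom.ofLinearMap φ.toLin φ.map_one φ.map_mul

theorem CDGAHom.alg_apply {S T : CDGA} (φ : CDGAHom S T) (a : S.carrier) :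
    φ.alg a = φ.toLin a := rfl

namespace HMdl

variable {W : GradedVS} {A : CDGA} (H : HMdl W A)

/-- generators -/
def j (n : ℕ) : W.V n →ₗ[ℝ] H.E :=
  H.e.toLinearMap ∘ₗ ExteriorAlgebra.ι ℝ ∘ₗ DirectSum.lof ℝ ℕ W.V n

theorem j_apply (n : ℕ) (v : W.V n) :
    H.j n v = H.e (ExteriorAlgebra.ι ℝ (DirectSum.lof ℝ ℕ W.V n v)) := rfl

theorem j_anti (m n : ℕ) (v : W.V m) (w : W.V n) : H.j m v * H.j n w = - (H.j n w * H.j m v) := by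
  rw [j_apply, j_apply, ← map_mul H.e, ← map_mul H.e, ← map_neg]
  congr 1
  exact eq_neg_of_add_eq_zero_left (ExteriorAlgebra.ι_add_mul_swap _ _)

theorem j_comm (p n : ℕ) (a : A.carrier) (v : W.V n) (ha : a ∈ A.grading p) :
    H.incl a * H.j n v = ((-1 : ℝ) ^ p) • (H.j n v * H.incl a) := H.comm p a _ ha

theorem lift' (C : Type) [Ring C] [Algebra ℝ C] (α : A.carrier →ₐ[ℝ] C)
    (k : ∀ n, W.V n →ₗ[ℝ] C)
    (anti : ∀ m n v w, k m v * k n w = - (k n w * k m v))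
    (comm : ∀ (p n : ℕ) (a : A.carrier) (v : W.V n), a ∈ A.grading p →
      α a * k n v = ((-1 : ℝ) ^ p) • (k n v * α a)) :
    ∃ Ψ : H.E →ₐ[ℝ] C, (∀ a, Ψ (H.incl a) = α a) ∧ ∀ n v, Ψ (H.j n v) = k n v := by
  let β : W.tot →ₗ[ℝ] C := DirectSum.toModule ℝ ℕ C k
  have hβ : ∀ n v, β (DirectSum.lof ℝ ℕ W.V n v) = k n v := fun n v =>
    DirectSum.toModule_lof ℝ n v
  have h1 : ∀ m m', β m * β m' = - (β m' * β m) := by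
    intro m m'
    induction m using DirectSum.induction_on with
    | zero => simp
    | add x y hx hy => rw [map_add, add_mul, mul_add, hx, hy, neg_add]
    | of i x =>
      induction m' using DirectSum.induction_on with
      | zero => simp
      | add x y hx hy => rw [map_add, add_mul, mul_add, hx, hy, neg_add]
      | of i' x' =>
        rw [← DirectSum.lof_eq_of ℝ, ← DirectSum.lof_eq_of ℝ, hβ, hβ, anti]
  obtain ⟨Ψ, h2, h3⟩ := H.lift C α β (fun m => by
      have h := h1 m m
      have h' : (2 : ℝ) • (β m * β m) = 0 := by
        rw [two_smul]; nth_rewrite 1 [h]; simp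
      simpa using h') (by
      intro n a m ha
      induction m using DirectSum.induction_on with
      | zero => simp
      | add x y hx hy => rw [map_add, add_mul, mul_add, hx, hy, smul_add]
      | of i x => rw [← DirectSum.lof_eq_of ℝ, hβ, comm n i a x ha])
  exact ⟨Ψ, h2, fun n v => by rw [j_apply, h3, hβ]⟩

/-- Monomials of a given degree. -/
inductive Mon : ℕ → H.E → Prop
  | incl (n : ℕ) (a : A.carrier) (ha : a ∈ A.grading n) : Mon n (H.incl a)
  | gen (n : ℕ) (v : W.V n) : Mon n (H.j n v)
  | mul (m n : ℕ) (x y : H.E) (hx : Mon m x) (hy : Mon n y) : Mon (m + n) (x * y)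

/-- The total grading. -/
def gr (n : ℕ) : Submodule ℝ H.E := Submodule.span ℝ {x | H.Mon n x}

theorem incl_mem {n : ℕ} {a : A.carrier} (ha : a ∈ A.grading n) : H.incl a ∈ H.gr n :=
  Submodule.subset_span (Mon.incl n a ha)

theorem j_mem (n : ℕ) (v : W.V n) : H.j n v ∈ H.gr n :=
  Submodule.subset_span (Mon.gen n v)

theorem gr_mul {m n : ℕ} {x y : H.E} (hx : x ∈ H.gr m) (hy : y ∈ H.gr n) :
    x * y ∈ H.gr (m + n) := by
  have h := Submodule.mul_mem_mul hx hy
  rw [gr, gr, Submodule.span_mul_span] at h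
  refine Submodule.span_mono ?_ h
  rintro _ ⟨x, hx, y, hy, rfl⟩
  exact Mon.mul m n x y hx hy

theorem gr_le (Q : ℕ → Submodule ℝ H.E)
    (h1 : ∀ n a, a ∈ A.grading n → H.incl a ∈ Q n)
    (h2 : ∀ n v, H.j n v ∈ Q n)
    (hm : ∀ m n x y, x ∈ H.gr m → y ∈ H.gr n → x ∈ Q m → y ∈ Q n → x * y ∈ Q (m + n))
    (n : ℕ) : H.gr n ≤ Q n := by
  refine Submodule.span_le.mpr ?_
  intro x hx
  induction hx with
  | incl n a ha => exact h1 n a ha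
  | gen n v => exact h2 n v
  | mul m n x y hx hy ihx ihy =>
    exact hm m n x y (Submodule.subset_span hx) (Submodule.subset_span hy) ihx ihy

theorem one_mem : (1 : H.E) ∈ H.gr 0 := by
  rw [← map_one H.incl]; exact H.incl_mem A.one_mem

theorem gr_top : ⨆ n, H.gr n = ⊤ := by
  have hmul : ∀ x y, x ∈ ⨆ n, H.gr n → y ∈ ⨆ n, H.gr n → x * y ∈ ⨆ n, H.gr n := by
    intro x y hx hy
    have h := Submodule.mul_mem_mul hx hy
    simp only [Submodule.iSup_mul, Submodule.mul_iSup] at h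
    refine (iSup_le fun m => iSup_le fun n => ?_ : _ ≤ ⨆ n, H.gr n) h
    refine (Submodule.mul_le.mpr fun x hx y hy => ?_)
    exact Submodule.mem_iSup_of_mem _ (H.gr_mul hx hy)
  have hi : ∀ a, H.incl a ∈ ⨆ n, H.gr n := by
    intro a
    have : (⊤ : Submodule ℝ A.carrier) ≤ (⨆ n, H.gr n).comap H.incl.toLinearMap := by
      rw [← A.iSup_grading]
      exact iSup_le fun n a ha => Submodule.mem_iSup_of_mem n (H.incl_mem ha)
    exact this (Submodule.mem_top : a ∈ ⊤)
  have he : ∀ b, H.e b ∈ ⨆ n, H.gr n := by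
    intro b
    induction b using ExteriorAlgebra.induction with
    | algebraMap r =>
      rw [Algebra.algebraMap_eq_smul_one, map_smul, map_one]
      exact Submodule.smul_mem _ _ (Submodule.mem_iSup_of_mem 0 H.one_mem)
    | ι m =>
      induction m using DirectSum.induction_on with
      | zero => simp
      | add x y hx hy => rw [map_add, map_add]; exact Submodule.add_mem _ hx hy
      | of i x => exact Submodule.mem_iSup_of_mem i (H.j_mem i x)
    | mul a b ha hb => rw [map_mul]; exact hmul _ _ ha hb
    | add a b ha hb => rw [map_add]; exact Submodule.add_mem _ ha hb
  rw [Submodule.eq_top_iff']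
  intro x
  obtain ⟨t, rfl⟩ := H.bij.2 x
  induction t using TensorProduct.induction_on with
  | zero => simp
  | tmul a b => exact hmul _ _ (hi a) (he b)
  | add x y hx hy => rw [map_add]; exact Submodule.add_mem _ hx hy

theorem top_le {Q : Submodule ℝ H.E} (h : ∀ n, H.gr n ≤ Q) (x : H.E) : x ∈ Q := by
  have : (⊤ : Submodule ℝ H.E) ≤ Q := by rw [← H.gr_top]; exact iSup_le h
  exact this Submodule.mem_top

theorem exists_rho : ∃ ρ : H.E →ₐ[ℝ] Polynomial H.E,
    ∀ n, ∀ x ∈ H.gr n, ρ x = Polynomial.monomial n x := by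
  obtain ⟨α, hα⟩ := A.exists_algHom (C := Polynomial H.E)
    (fun n => ((Polynomial.monomial n : H.E →ₗ[H.E] Polynomial H.E).restrictScalars ℝ).comp
      H.incl.toLinearMap) (by simp) (by
      intro m n a b ha hb
      simp [Polynomial.monomial_mul_monomial])
  obtain ⟨ρ, h1, h2⟩ := H.lift' (Polynomial H.E) α
    (fun n => ((Polynomial.monomial n : H.E →ₗ[H.E] Polynomial H.E).restrictScalars ℝ).comp (H.j n))
    (by
      intro m n v w
      simp only [LinearMap.comp_apply, LinearMap.restrictScalars_apply,
        Polynomial.monomial_mul_monomial]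
      rw [H.j_anti, map_neg, add_comm])
    (by
      intro p n a v ha
      rw [hα p a ha]
      simp only [LinearMap.comp_apply, LinearMap.restrictScalars_apply,
        Polynomial.monomial_mul_monomial, AlgHom.toLinearMap_apply]
      rw [H.j_comm p n a v ha, Polynomial.smul_monomial, add_comm])
  refine ⟨ρ, fun n => H.gr_le (fun n => LinearMap.eqLocus ρ.toLinearMap
    ((Polynomial.monomial n : H.E →ₗ[H.E] Polynomial H.E).restrictScalars ℝ)) ?_ ?_ ?_ n⟩
  · intro n a ha
    simp [LinearMap.mem_eqLocus, h1, hα n a ha]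
  · intro n v
    simp [LinearMap.mem_eqLocus, h2]
  · intro m n x y _ _ hx hy
    simp only [LinearMap.mem_eqLocus, AlgHom.toLinearMap_apply,
      LinearMap.restrictScalars_apply] at hx hy ⊢
    rw [map_mul, hx, hy, Polynomial.monomial_mul_monomial]

theorem gr_internal : DirectSum.IsInternal H.gr := by
  obtain ⟨ρ, hρ⟩ := H.exists_rho
  rw [DirectSum.isInternal_submodule_iff_iSupIndep_and_iSup_eq_top]
  refine ⟨?_, H.gr_top⟩
  refine iSupIndep_def.mpr fun n => ?_
  rw [Submodule.disjoint_def]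
  intro x hx hx'
  have hle : (⨆ i, ⨆ (_ : i ≠ n), H.gr i) ≤
      LinearMap.ker (((Polynomial.lcoeff H.E n).restrictScalars ℝ).comp ρ.toLinearMap) := by
    refine iSup_le fun i => iSup_le fun hi => fun y hy => ?_
    simp [hρ i y hy, Polynomial.coeff_monomial, hi]
  have := hle hx'
  simpa [hρ n x hx, Polynomial.coeff_monomial] using this

end HMdl

/-- Upper triangular matrix valued linear map. -/
def utm {M E : Type} [AddCommGroup M] [Module ℝ M] [Ring E] [Algebra ℝ E]
    (p q r : M →ₗ[ℝ] E) : M →ₗ[ℝ] Matrix (Fin 2) (Fin 2) E where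
  toFun a := !![p a, q a; 0, r a]
  map_add' x y := by ext i j; fin_cases i <;> fin_cases j <;> simp
  map_smul' c x := by ext i j; fin_cases i <;> fin_cases j <;> simp

theorem utm_apply {M E : Type} [AddCommGroup M] [Module ℝ M] [Ring E] [Algebra ℝ E]
    (p q r : M →ₗ[ℝ] E) (a : M) : utm p q r a = !![p a, q a; 0, r a] := rfl

theorem neg_one_sq_pow (n : ℕ) : ((-1 : ℝ) ^ n) * ((-1 : ℝ) ^ n) = 1 := by
  rw [← mul_pow]; simp

namespace HMdl

variable {W : GradedVS} {A : CDGA} (H : HMdl W A)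

theorem f_j_comm (hW : ∀ n : ℕ, Even n → ∀ v : W.V n, v = 0) (F : VStr W A)
    (m n : ℕ) (v : W.V m) (w : W.V n) :
    H.incl (F.f m v) * H.j n w = H.j n w * H.incl (F.f m v) := by
  rcases Nat.even_or_odd m with hm | hm
  · rw [hW m hm v]; simp
  · rw [H.j_comm (m + 1) n _ w (F.f_mem m v), hm.add_one.neg_one_pow, one_smul]

theorem f_incl_comm (hW : ∀ n : ℕ, Even n → ∀ v : W.V n, v = 0) (F : VStr W A)
    (p n : ℕ) (a : A.carrier) (v : W.V n) (ha : a ∈ A.grading p) :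
    H.incl a * H.incl (F.f n v) = H.incl (F.f n v) * H.incl a := by
  rcases Nat.even_or_odd n with hm | hm
  · rw [hW n hm v]; simp
  · rw [← map_mul, A.gcomm ha (F.f_mem n v), (hm.add_one.mul_left p).neg_one_pow, one_smul,
      map_mul]

theorem exists_D (hW : ∀ n : ℕ, Even n → ∀ v : W.V n, v = 0) (F : VStr W A) :
    ∃ D : H.E →ₗ[ℝ] H.E, (∀ a, D (H.incl a) = H.incl (A.d a)) ∧
      (∀ n v, D (H.j n v) = H.incl (F.f n v)) ∧
      ∀ m, ∀ x ∈ H.gr m, ∀ y, D (x * y) = D x * y + ((-1 : ℝ) ^ m) • (x * D y) := by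
  obtain ⟨α, hα⟩ := A.exists_algHom (C := Matrix (Fin 2) (Fin 2) H.E)
    (fun n => utm (((-1 : ℝ) ^ n) • H.incl.toLinearMap) (H.incl.toLinearMap ∘ₗ A.d)
      H.incl.toLinearMap) (by
        have hd : A.d 1 = 0 := by
          have := A.leibniz A.one_mem 1
          simpa using this
        rw [utm_apply, Matrix.one_fin_two]
        simp [hd]) (by
      intro m n a b ha hb
      simp only [utm_apply, Matrix.mul_fin_two]
      ext i j
      fin_cases i <;> fin_cases j <;>
        simp [pow_add, smul_smul, A.leibniz ha, mul_comm, add_comm])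
  obtain ⟨Ψ, h1, h2⟩ := H.lift' (Matrix (Fin 2) (Fin 2) H.E) α
    (fun n => utm (-H.j n) (H.incl.toLinearMap ∘ₗ F.f n) (H.j n))
    (by
      intro m n v w
      simp only [utm_apply, Matrix.mul_fin_two]
      ext i j
      fin_cases i <;> fin_cases j <;>
        simp [H.j_anti m n v w, H.f_j_comm hW F])
    (by
      intro p n a v ha
      rw [hα p a ha]
      simp only [utm_apply, Matrix.mul_fin_two]
      ext i j
      fin_cases i <;> fin_cases j <;>
        simp [H.j_comm p n a v ha, H.j_comm (p + 1) n _ v (A.d_mem ha), smul_smul,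
          f_incl_comm H hW F p n a v ha, pow_succ, add_comm])
  have hmem : ∀ n, ∀ x ∈ H.gr n, Ψ x 0 0 = ((-1 : ℝ) ^ n) • x ∧ Ψ x 1 0 = 0 ∧ Ψ x 1 1 = x := by
    let ent (i j : Fin 2) : H.E →ₗ[ℝ] H.E := (Matrix.entryLinearMap ℝ H.E i j) ∘ₗ Ψ.toLinearMap
    have key := H.gr_le (fun n =>
      LinearMap.eqLocus (ent 0 0) (((-1 : ℝ) ^ n) • LinearMap.id) ⊓
      (LinearMap.ker (ent 1 0) ⊓ LinearMap.eqLocus (ent 1 1) LinearMap.id)) ?_ ?_ ?_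
    · intro n x hx
      simpa [ent] using key n hx
    · intro n a ha
      simp [ent, h1, hα n a ha, utm_apply]
    · intro n v
      rcases Nat.even_or_odd n with hn | hn
      · rw [hW n hn v]; simp
      · simp [ent, h2, utm_apply, hn.neg_one_pow]
    · intro m n x y _ _ hx hy
      simp only [Submodule.mem_inf, LinearMap.mem_eqLocus, LinearMap.mem_ker, ent,
        LinearMap.comp_apply, AlgHom.toLinearMap_apply, Matrix.entryLinearMap_apply,
        LinearMap.smul_apply, LinearMap.id_apply, map_mul, Matrix.mul_apply,
        Fin.sum_univ_two] at hx hy ⊢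
      obtain ⟨hx1, hx2, hx3⟩ := hx
      obtain ⟨hy1, hy2, hy3⟩ := hy
      rw [hx1, hx2, hx3, hy1, hy2, hy3]
      simp [pow_add, smul_smul, mul_comm]
  have h11 : ∀ x, Ψ x 1 1 = x := fun x =>
    H.top_le (Q := LinearMap.eqLocus ((Matrix.entryLinearMap ℝ H.E 1 1) ∘ₗ Ψ.toLinearMap)
      LinearMap.id) (fun n x hx => (hmem n x hx).2.2) x
  refine ⟨(Matrix.entryLinearMap ℝ H.E 0 1) ∘ₗ Ψ.toLinearMap, ?_, ?_, ?_⟩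
  · intro a
    refine LinearMap.congr_fun (f := ((Matrix.entryLinearMap ℝ H.E 0 1) ∘ₗ Ψ.toLinearMap) ∘ₗ
      H.incl.toLinearMap) (g := H.incl.toLinearMap ∘ₗ A.d) (A.lin_ext fun n a ha => ?_) a
    simp [h1, hα n a ha, utm_apply]
  · intro n v
    simp [h2, utm_apply]
  · intro m x hx y
    simp [Matrix.mul_apply, Fin.sum_univ_two, (hmem m x hx).1, h11, add_comm]

/-- The differential. -/
def D (hW : ∀ n : ℕ, Even n → ∀ v : W.V n, v = 0) (F : VStr W A) : H.E →ₗ[ℝ] H.E :=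
  Classical.choose (H.exists_D hW F)

variable (hW : ∀ n : ℕ, Even n → ∀ v : W.V n, v = 0) (F : VStr W A)

theorem D_incl (a : A.carrier) : H.D hW F (H.incl a) = H.incl (A.d a) :=
  (Classical.choose_spec (H.exists_D hW F)).1 a

theorem D_j (n : ℕ) (v : W.V n) : H.D hW F (H.j n v) = H.incl (F.f n v) :=
  (Classical.choose_spec (H.exists_D hW F)).2.1 n v

theorem D_mul {m : ℕ} {x : H.E} (hx : x ∈ H.gr m) (y : H.E) :
    H.D hW F (x * y) = H.D hW F x * y + ((-1 : ℝ) ^ m) • (x * H.D hW F y) :=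
  (Classical.choose_spec (H.exists_D hW F)).2.2 m x hx y

theorem D_mem {n : ℕ} {x : H.E} (hx : x ∈ H.gr n) : H.D hW F x ∈ H.gr (n + 1) := by
  refine H.gr_le (fun n => (H.gr (n + 1)).comap (H.D hW F)) ?_ ?_ ?_ n hx
  · intro n a ha
    rw [Submodule.mem_comap, D_incl]; exact H.incl_mem (A.d_mem ha)
  · intro n v
    rw [Submodule.mem_comap, D_j]; exact H.incl_mem (F.f_mem n v)
  · intro m n x y hx hy hx' hy'
    rw [Submodule.mem_comap] at hx' hy' ⊢
    rw [H.D_mul hW F hx]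
    refine Submodule.add_mem _ ?_ (Submodule.smul_mem _ _ ?_)
    · have := H.gr_mul hx' hy
      rwa [add_right_comm] at this
    · have := H.gr_mul hx hy'
      rwa [← add_assoc] at this

theorem D_D (x : H.E) : H.D hW F (H.D hW F x) = 0 := by
  refine H.top_le (Q := LinearMap.ker (H.D hW F ∘ₗ H.D hW F)) (H.gr_le _ ?_ ?_ ?_) x
  · intro n a ha
    simp [D_incl, A.d_d]
  · intro n v
    simp [D_j, D_incl, F.f_closed]
  · intro m n x y hx hy hx' hy'
    simp only [LinearMap.mem_ker, LinearMap.comp_apply] at hx' hy' ⊢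
    rw [H.D_mul hW F hx, map_add, map_smul, H.D_mul hW F (H.D_mem hW F hx), H.D_mul hW F hx,
      hx', hy', pow_succ]
    simp

theorem comm_aux (x : H.E) (m : ℕ)
    (h1 : ∀ n a, a ∈ A.grading n → x * H.incl a = ((-1 : ℝ) ^ (m * n)) • (H.incl a * x))
    (h2 : ∀ n v, x * H.j n v = ((-1 : ℝ) ^ (m * n)) • (H.j n v * x))
    (n : ℕ) (y : H.E) (hy : y ∈ H.gr n) : x * y = ((-1 : ℝ) ^ (m * n)) • (y * x) := by
  refine H.gr_le (fun n => LinearMap.eqLocus (LinearMap.mulLeft ℝ x)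
    (((-1 : ℝ) ^ (m * n)) • LinearMap.mulRight ℝ x)) ?_ ?_ ?_ n hy
  · exact h1
  · exact h2
  · intro n n' y z _ _ hy hz
    simp only [LinearMap.mem_eqLocus, LinearMap.mulLeft_apply, LinearMap.smul_apply,
      LinearMap.mulRight_apply] at hy hz ⊢
    rw [← mul_assoc, hy, smul_mul_assoc, mul_assoc, hz, mul_smul_comm, smul_smul, mul_add, pow_add,
      mul_assoc]

theorem flip_comm {x y : H.E} {m n : ℕ} (h : x * y = ((-1 : ℝ) ^ (m * n)) • (y * x)) :
    y * x = ((-1 : ℝ) ^ (n * m)) • (x * y) := by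
  rw [h, smul_smul, mul_comm n m, neg_one_sq_pow, one_smul]

theorem j_comm' (hW : ∀ n : ℕ, Even n → ∀ v : W.V n, v = 0) (p n : ℕ) (a : A.carrier) (v : W.V n) (ha : a ∈ A.grading p) :
    H.incl a * H.j n v = ((-1 : ℝ) ^ (p * n)) • (H.j n v * H.incl a) := by
  rcases Nat.even_or_odd n with hn | hn
  · rw [hW n hn v]; simp
  · rw [H.j_comm p n a v ha, mul_comm, pow_mul, hn.neg_one_pow]

theorem gr_comm (hW : ∀ n : ℕ, Even n → ∀ v : W.V n, v = 0) {m n : ℕ} {x y : H.E} (hx : x ∈ H.gr m) (hy : y ∈ H.gr n) :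
    x * y = ((-1 : ℝ) ^ (m * n)) • (y * x) := by
  apply H.flip_comm
  refine H.comm_aux y n (fun p a ha => ?_) (fun p v => ?_) m x hx
  · apply H.flip_comm
    refine H.comm_aux (H.incl a) p (fun q b hb => ?_) (fun q w => ?_) n y hy
    · rw [← map_mul, A.gcomm ha hb, map_smul, map_mul]
    · exact H.j_comm' hW p q a w ha
  · apply H.flip_comm
    refine H.comm_aux (H.j p v) p (fun q b hb => ?_) (fun q w => ?_) n y hy
    · exact H.flip_comm (H.j_comm' hW q p b v hb)
    · rcases Nat.even_or_odd p with hp | hp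
      · rw [hW p hp v]; simp
      rcases Nat.even_or_odd q with hq | hq
      · rw [hW q hq w]; simp
      rw [H.j_anti, (hp.mul hq).neg_one_pow, neg_one_smul]

/-- The Hirsch extension as a CDGA. -/
def cdga : CDGA where
  carrier := H.E
  grading := H.gr
  one_mem := H.one_mem
  mul_mem := H.gr_mul
  internal := H.gr_internal
  gcomm := H.gr_comm hW
  d := H.D hW F
  d_mem := H.D_mem hW F
  d_d := H.D_D hW F
  leibniz := fun hx y => H.D_mul hW F hx y

/-- The inclusion. -/
def inclHom : CDGAHom A (H.cdga hW F) where
  toLin := H.incl.toLinearMap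
  map_one := map_one H.incl
  map_mul := map_mul H.incl
  map_grading := fun h => H.incl_mem h
  map_d := fun a => (H.D_incl hW F a).symm

theorem universal (C : CDGA) (ψ : CDGAHom A C) (k : ∀ n, W.V n →ₗ[ℝ] C.carrier)
    (hk : ∀ n v, k n v ∈ C.grading n) (hdk : ∀ n v, C.d (k n v) = ψ.toLin (F.f n v)) :
    ∃! Φ : CDGAHom (H.cdga hW F) C, (∀ a, Φ.toLin ((H.inclHom hW F).toLin a) = ψ.toLin a) ∧
      ∀ n v, Φ.toLin (H.j n v) = k n v := by
  obtain ⟨Ψ, h1, h2⟩ := H.lift' C.carrier ψ.alg k (by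
      intro p q v w
      rcases Nat.even_or_odd p with hp | hp
      · rw [hW p hp v]; simp
      rcases Nat.even_or_odd q with hq | hq
      · rw [hW q hq w]; simp
      rw [C.gcomm (hk p v) (hk q w), (hp.mul hq).neg_one_pow, neg_one_smul]) (by
      intro p n a v ha
      rcases Nat.even_or_odd n with hn | hn
      · rw [hW n hn v]; simp
      rw [CDGAHom.alg_apply, C.gcomm (ψ.map_grading ha) (hk n v), mul_comm p n, pow_mul,
        hn.neg_one_pow])
  have hgr : ∀ n, ∀ x ∈ H.gr n, Ψ x ∈ C.grading n := by
    intro n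
    refine H.gr_le (fun n => (C.grading n).comap Ψ.toLinearMap) ?_ ?_ ?_ n
    · intro n a ha
      show Ψ (H.incl a) ∈ C.grading n
      rw [h1]
      exact ψ.map_grading ha
    · intro n v
      simpa [h2] using hk n v
    · intro m n x y _ _ hx hy
      simpa using C.mul_mem hx hy
  refine ⟨⟨Ψ.toLinearMap, map_one Ψ, map_mul Ψ, fun h => hgr _ _ h, ?_⟩, ⟨h1, h2⟩, ?_⟩
  · intro x
    refine H.top_le (Q := LinearMap.eqLocus (Ψ.toLinearMap ∘ₗ H.D hW F) (C.d ∘ₗ Ψ.toLinearMap))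
      (H.gr_le _ ?_ ?_ ?_) x
    · intro n a ha
      simp [D_incl, h1, CDGAHom.alg_apply, ψ.map_d]
    · intro n v
      simp [D_j, h1, h2, CDGAHom.alg_apply, hdk]
    · intro m n x y hx hy hx' hy'
      simp only [LinearMap.mem_eqLocus, LinearMap.comp_apply, AlgHom.toLinearMap_apply]
        at hx' hy' ⊢
      rw [H.D_mul hW F hx, map_add, map_smul, map_mul, map_mul, map_mul, hx', hy',
        C.leibniz (hgr _ _ hx)]
  · rintro Φ ⟨h3, h4⟩
    apply CDGAHom.ext'
    refine LinearMap.ext fun x => ?_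
    refine H.top_le (Q := LinearMap.eqLocus (M := H.E) Φ.toLin Ψ.toLinearMap)
      (H.gr_le _ ?_ ?_ ?_) x
    · intro n a ha
      exact (h3 a).trans (h1 a).symm
    · intro n v
      exact (h4 n v).trans (h2 n v).symm
    · intro m n x y _ _ hx hy
      exact (Φ.map_mul x y).trans ((congrArg₂ (· * ·) hx hy).trans (map_mul Ψ x y).symm)

/-- It is a Hirsch extension. -/
def isHirsch : IsHirschExt W F (H.cdga hW F) where
  incl := H.inclHom hW F
  j := H.j
  j_mem := H.j_mem
  dj := H.D_j hW F
  universal := H.universal hW F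

end HMdl

/-- Acyclicity of the mapping cone (ungraded form). -/
def Acyc {M N : Type} [AddCommGroup M] [Module ℝ M] [AddCommGroup N] [Module ℝ N]
    (dM : M →ₗ[ℝ] M) (dN : N →ₗ[ℝ] N) (Φ : M →ₗ[ℝ] N) : Prop :=
  ∀ x y, dM x = 0 → dN y = Φ x → ∃ x' y', dM x' = x ∧ y = Φ x' + dN y'

section filt

variable {K : Type} (ℓ : K → ℕ) {A B : Type} [AddCommGroup A] [Module ℝ A]
  [AddCommGroup B] [Module ℝ B]

/-- Finitely supported functions supported in filtration `< p`. -/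
def LE' (A : Type) [AddCommGroup A] [Module ℝ A] (p : ℕ) : Submodule ℝ (K →₀ A) where
  carrier := {x | ∀ k, p ≤ ℓ k → x k = 0}
  add_mem' := by
    intro x y hx hy k hk
    simp [hx k hk, hy k hk]
  zero_mem' := by intro k _; simp
  smul_mem' := by
    intro c x hx k hk
    simp [hx k hk]

theorem mem_LE' {p : ℕ} {x : K →₀ A} : x ∈ LE' ℓ A p ↔ ∀ k, p ≤ ℓ k → x k = 0 := Iff.rfl

theorem LE'_coef (T : (K →₀ A) →ₗ[ℝ] (K →₀ B)) (t : A →ₗ[ℝ] B)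
    (hT : ∀ k a, T (Finsupp.single k a) - Finsupp.single k (t a) ∈ LE' ℓ B (ℓ k))
    (p : ℕ) (x : K →₀ A) (hx : x ∈ LE' ℓ A (p + 1)) (k : K) (hk : p ≤ ℓ k) :
    T x k = t (x k) := by
  have h : T x - Finsupp.mapRange.linearMap t x ∈ LE' ℓ B p := by
    have h2 : T x - Finsupp.mapRange.linearMap t x
        = ∑ k ∈ x.support, (T (Finsupp.single k (x k)) - Finsupp.single k (t (x k))) := by
      conv_lhs => rw [← Finsupp.sum_single x]
      rw [Finsupp.sum, map_sum, map_sum, ← Finset.sum_sub_distrib]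
      refine Finset.sum_congr rfl fun k _ => ?_
      simp
    rw [h2]
    refine Submodule.sum_mem _ fun k' hk' => ?_
    intro k'' hk''
    refine hT k' (x k') k'' (le_trans ?_ hk'')
    by_contra hlt
    exact (Finsupp.mem_support_iff.mp hk') (hx k' (by omega))
  have := h k hk
  simpa [sub_eq_zero] using this

theorem acyc_filt (dA : A →ₗ[ℝ] A) (dB : B →ₗ[ℝ] B) (φ : A →ₗ[ℝ] B) (hφ : Acyc dA dB φ)
    (DE : (K →₀ A) →ₗ[ℝ] (K →₀ A)) (DF : (K →₀ B) →ₗ[ℝ] (K →₀ B))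
    (Φ : (K →₀ A) →ₗ[ℝ] (K →₀ B)) (hE : ∀ x, DE (DE x) = 0) (hF : ∀ x, DF (DF x) = 0)
    (hc : ∀ x, DF (Φ x) = Φ (DE x))
    (h1 : ∀ k a, DE (Finsupp.single k a) - Finsupp.single k (dA a) ∈ LE' ℓ A (ℓ k))
    (h2 : ∀ k a, DF (Finsupp.single k a) - Finsupp.single k (dB a) ∈ LE' ℓ B (ℓ k))
    (h3 : ∀ k a, Φ (Finsupp.single k a) - Finsupp.single k (φ a) ∈ LE' ℓ B (ℓ k)) :
    Acyc DE DF Φ := by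
  have key : ∀ p x y, x ∈ LE' ℓ A p → y ∈ LE' ℓ B p → DE x = 0 → DF y = Φ x →
      ∃ x' y', DE x' = x ∧ y = Φ x' + DF y' := by
    intro p
    induction p with
    | zero =>
        intro x y hx hy _ _
        have hx0 : x = 0 := Finsupp.ext fun k => hx k (Nat.zero_le _)
        have hy0 : y = 0 := Finsupp.ext fun k => hy k (Nat.zero_le _)
        exact ⟨0, 0, by simp [hx0], by simp [hy0]⟩
    | succ p ih =>
        intro x y hx hy hdx hdy
        have hch : ∀ k, ∃ (a : A) (b : B), (ℓ k = p → dA a = x k ∧ y k = φ a + dB b) ∧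
            (x k = 0 → y k = 0 → a = 0 ∧ b = 0) ∧ (ℓ k ≠ p → a = 0 ∧ b = 0) := by
          intro k
          by_cases hk : ℓ k = p
          · by_cases h0 : x k = 0 ∧ y k = 0
            · exact ⟨0, 0, fun _ => by simp [h0], fun _ _ => ⟨rfl, rfl⟩, fun _ => ⟨rfl, rfl⟩⟩
            · have e1 := LE'_coef ℓ DE dA h1 p x hx k hk.ge
              have e2 := LE'_coef ℓ DF dB h2 p y hy k hk.ge
              have e3 := LE'_coef ℓ Φ φ h3 p x hx k hk.ge
              obtain ⟨a, b, hab⟩ := hφ (x k) (y k) (by rw [← e1, hdx]; rfl)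
                (by rw [← e2, hdy, e3])
              exact ⟨a, b, fun _ => hab, fun h h' => absurd ⟨h, h'⟩ h0, fun h => absurd hk h⟩
          · exact ⟨0, 0, fun h => absurd h hk, fun _ _ => ⟨rfl, rfl⟩, fun _ => ⟨rfl, rfl⟩⟩
        choose a b hab h0 hne using hch
        classical
        have hsupp : ∀ k, ¬ (x k = 0 ∧ y k = 0) → k ∈ x.support ∪ y.support := by
          intro k hk
          rw [Finset.mem_union, Finsupp.mem_support_iff, Finsupp.mem_support_iff]
          tauto
        let x' : K →₀ A := Finsupp.onFinset (x.support ∪ y.support) a (fun k hk =>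
          hsupp k fun h => hk (h0 k h.1 h.2).1)
        let y' : K →₀ B := Finsupp.onFinset (x.support ∪ y.support) b (fun k hk =>
          hsupp k fun h => hk (h0 k h.1 h.2).2)
        have hx' : x' ∈ LE' ℓ A (p + 1) := fun k hk => (hne k (by omega)).1
        have hy' : y' ∈ LE' ℓ B (p + 1) := fun k hk => (hne k (by omega)).2
        obtain ⟨x1, y1, e1, e2⟩ := ih (x - DE x') (y - Φ x' - DF y') (by
            intro k hk
            rw [Finsupp.sub_apply, LE'_coef ℓ DE dA h1 p x' hx' k hk]
            show x k - dA (a k) = 0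
            by_cases hkp : ℓ k = p
            · rw [(hab k hkp).1, sub_self]
            · rw [(hne k hkp).1, hx k (by omega)]; simp) (by
            intro k hk
            rw [Finsupp.sub_apply, Finsupp.sub_apply, LE'_coef ℓ Φ φ h3 p x' hx' k hk,
              LE'_coef ℓ DF dB h2 p y' hy' k hk]
            show y k - φ (a k) - dB (b k) = 0
            by_cases hkp : ℓ k = p
            · rw [(hab k hkp).2]; abel
            · rw [(hne k hkp).1, (hne k hkp).2, hy k (by omega)]; simp)
            (by rw [map_sub, hdx, hE, sub_zero])
            (by rw [map_sub, map_sub, map_sub, hdy, hF, hc, sub_zero])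
        refine ⟨x' + x1, y' + y1, ?_, ?_⟩
        · rw [map_add, e1]; abel
        · rw [map_add, map_add]
          have : y = (y - Φ x' - DF y') + Φ x' + DF y' := by abel
          rw [this, e2]; abel
  intro x y
  have hb : ∃ p, x ∈ LE' ℓ A p ∧ y ∈ LE' ℓ B p := by
    refine ⟨(∑ k ∈ x.support, ℓ k) + (∑ k ∈ y.support, ℓ k) + 1, ?_, ?_⟩
    · intro k hk
      by_contra h
      have := Finset.single_le_sum (f := ℓ) (fun _ _ => Nat.zero_le _)
        (Finsupp.mem_support_iff.mpr h)
      omega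
    · intro k hk
      by_contra h
      have := Finset.single_le_sum (f := ℓ) (fun _ _ => Nat.zero_le _)
        (Finsupp.mem_support_iff.mpr h)
      omega
  obtain ⟨p, hx, hy⟩ := hb
  exact key p x y hx hy

end filt

theorem CDGA.exists_pr (A : CDGA) : ∃ pr : ℕ → A.carrier →ₗ[ℝ] A.carrier,
    (∀ n a, pr n a ∈ A.grading n) ∧ (∀ n a, a ∈ A.grading n → pr n a = a) ∧
    (∀ m n a, a ∈ A.grading m → m ≠ n → pr n a = 0) ∧
    ∀ x, ∃ N, ∀ M, N ≤ M → x = ∑ n ∈ Finset.range M, pr n x := by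
  let := A.ga
  have e0 : ∀ n a, GradedRing.proj A.grading n a = DirectSum.decompose A.grading a n :=
    fun _ _ => rfl
  have e1 : ∀ n a, a ∈ A.grading n → (DirectSum.decompose A.grading a n : A.carrier) = a :=
    fun n a ha => DirectSum.decompose_of_mem_same A.grading ha
  have e2 : ∀ m n a, a ∈ A.grading m → m ≠ n →
    (DirectSum.decompose A.grading a n : A.carrier) = 0 :=
    fun m n a ha h => DirectSum.decompose_of_mem_ne A.grading ha h
  let pr : ℕ → A.carrier →ₗ[ℝ] A.carrier := fun n =>
    { toFun := fun a => DirectSum.decompose A.grading a n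
      map_add' := by intro x y; simp
      map_smul' := by
        intro c x
        rw [DirectSum.decompose_smul]
        rfl }
  refine ⟨pr, ?_, e1, e2, ?_⟩
  · intro n a
    exact (DirectSum.decompose A.grading a n).2
  · intro x
    have hx : x ∈ ⨆ n, A.grading n := by rw [A.iSup_grading]; trivial
    induction hx using Submodule.iSup_induction' with
    | mem i x hx =>
        refine ⟨i + 1, fun M hM => ?_⟩
        rw [Finset.sum_eq_single i]
        · exact (e1 i x hx).symm
        · intro b _ hb
          exact e2 i b x hx hb.symm
        · intro h
          simp at h; omega
    | zero => exact ⟨0, fun M _ => by simp⟩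
    | add x y _ _ hx hy =>
        obtain ⟨N, hN⟩ := hx
        obtain ⟨N', hN'⟩ := hy
        refine ⟨max N N', fun M hM => ?_⟩
        simp only [map_add, Finset.sum_add_distrib]
        rw [← hN M (le_trans (le_max_left _ _) hM), ← hN' M (le_trans (le_max_right _ _) hM)]

/-- Homogeneous projections. -/
def CDGA.pr (A : CDGA) : ℕ → A.carrier →ₗ[ℝ] A.carrier := Classical.choose A.exists_pr

namespace CDGA
variable (A : CDGA)

theorem pr_mem (n : ℕ) (a : A.carrier) : A.pr n a ∈ A.grading n :=
  (Classical.choose_spec A.exists_pr).1 n a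

theorem pr_same {n : ℕ} {a : A.carrier} (h : a ∈ A.grading n) : A.pr n a = a :=
  (Classical.choose_spec A.exists_pr).2.1 n a h

theorem pr_ne {m n : ℕ} {a : A.carrier} (h : a ∈ A.grading m) (hmn : m ≠ n) : A.pr n a = 0 :=
  (Classical.choose_spec A.exists_pr).2.2.1 m n a h hmn

theorem pr_sum (x : A.carrier) : ∃ N, ∀ M, N ≤ M → x = ∑ n ∈ Finset.range M, A.pr n x :=
  (Classical.choose_spec A.exists_pr).2.2.2 x

theorem pr_d (n : ℕ) (a : A.carrier) : A.pr (n + 1) (A.d a) = A.d (A.pr n a) := by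
  refine LinearMap.congr_fun (f := A.pr (n + 1) ∘ₗ A.d) (g := A.d ∘ₗ A.pr n)
    (A.lin_ext fun m a ha => ?_) a
  by_cases h : m = n
  · subst h
    simp [A.pr_same ha, A.pr_same (A.d_mem ha)]
  · simp [A.pr_ne ha h, A.pr_ne (A.d_mem ha) (show m + 1 ≠ n + 1 by omega)]

theorem pr_zero_d (a : A.carrier) : A.pr 0 (A.d a) = 0 := by
  refine LinearMap.congr_fun (f := A.pr 0 ∘ₗ A.d) (g := 0)
    (A.lin_ext fun m a ha => ?_) a
  simp [A.pr_ne (A.d_mem ha) (show m + 1 ≠ 0 by omega)]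

theorem pr_d_mem (n : ℕ) (a : A.carrier) : A.pr n (A.d a) ∈ A.coboundaries n := by
  cases n with
  | zero => rw [pr_zero_d]; exact Submodule.zero_mem _
  | succ n => rw [pr_d]; exact ⟨_, A.pr_mem n a, rfl⟩

theorem pr_hom {S T : CDGA} (φ : CDGAHom S T) (n : ℕ) (a : S.carrier) :
    T.pr n (φ.toLin a) = φ.toLin (S.pr n a) := by
  refine LinearMap.congr_fun (f := T.pr n ∘ₗ φ.toLin) (g := φ.toLin ∘ₗ S.pr n)
    (S.lin_ext fun m a ha => ?_) a
  by_cases h : m = n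
  · subst h
    simp [S.pr_same ha, T.pr_same (φ.map_grading ha)]
  · simp [S.pr_ne ha h, T.pr_ne (φ.map_grading ha) h]

theorem cob_exists {n : ℕ} {x : A.carrier} (h : x ∈ A.coboundaries n) : ∃ y, A.d y = x := by
  cases n with
  | zero => exact ⟨0, by rw [map_zero]; exact ((Submodule.mem_bot ℝ).mp h).symm⟩
  | succ n => obtain ⟨y, _, h⟩ := h; exact ⟨y, h⟩

end CDGA

theorem CDGAHom.IsQuasiIso.acyc {S T : CDGA} {φ : CDGAHom S T} (h : φ.IsQuasiIso) :
    Acyc S.d T.d φ.toLin := by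
  intro x y hx hy
  have hcx : ∀ n, S.pr n x ∈ S.cocycles n := fun n => by
    refine Submodule.mem_inf.mpr ⟨?_, S.pr_mem n x⟩
    rw [LinearMap.mem_ker, ← S.pr_d, hx, map_zero]
  have hx0 : S.pr 0 x = 0 := by
    have := (h 0).1 _ (hcx 0) (by
      rw [← CDGA.pr_hom, ← hy]; exact T.pr_d_mem 0 y)
    exact (Submodule.mem_bot ℝ).mp this
  have hch : ∀ n, ∃ x' y', S.d x' = S.pr (n + 1) x ∧ T.pr n y = φ.toLin x' + T.d y' := by
    intro n
    obtain ⟨x'', hx'', hdx⟩ := (h (n + 1)).1 _ (hcx (n + 1)) (by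
      rw [← CDGA.pr_hom, ← hy]; exact T.pr_d_mem (n + 1) y)
    obtain ⟨z, hz, hz2⟩ := (h n).2 (T.pr n y - φ.toLin x'') (by
      refine Submodule.mem_inf.mpr ⟨?_, Submodule.sub_mem _ (T.pr_mem n y) (φ.map_grading hx'')⟩
      rw [LinearMap.mem_ker, map_sub, ← T.pr_d, hy, CDGA.pr_hom, ← φ.map_d, hdx, sub_self])
    obtain ⟨w, hw⟩ := T.cob_exists hz2
    refine ⟨x'' + z, -w, ?_, ?_⟩
    · rw [map_add, hdx, LinearMap.mem_ker.mp (Submodule.mem_inf.mp hz).1, add_zero]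
    · rw [map_add, map_neg, hw]; abel
  choose x' y' h1 h2 using hch
  obtain ⟨N, hN⟩ := S.pr_sum x
  obtain ⟨N', hN'⟩ := T.pr_sum y
  refine ⟨∑ n ∈ Finset.range (N + N'), x' n, ∑ n ∈ Finset.range (N + N'), y' n, ?_, ?_⟩
  · rw [map_sum]
    conv_rhs => rw [hN (N + N' + 1) (by omega), Finset.sum_range_succ', hx0, add_zero]
    exact Finset.sum_congr rfl fun n _ => h1 n
  · rw [map_sum, map_sum, ← Finset.sum_add_distrib]
    conv_lhs => rw [hN' (N + N') (by omega)]
    exact Finset.sum_congr rfl fun n _ => h2 n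

theorem Acyc.isQuasiIso {S T : CDGA} {φ : CDGAHom S T} (h : Acyc S.d T.d φ.toLin) :
    φ.IsQuasiIso := by
  intro n
  constructor
  · intro x hx hφ
    obtain ⟨hx1, hx2⟩ := Submodule.mem_inf.mp hx
    obtain ⟨y, hy⟩ := T.cob_exists hφ
    obtain ⟨x', y', h1, h2⟩ := h x y (LinearMap.mem_ker.mp hx1) hy
    rw [← S.pr_same hx2, ← h1]
    exact S.pr_d_mem n x'
  · intro y hy
    obtain ⟨hy1, hy2⟩ := Submodule.mem_inf.mp hy
    obtain ⟨x', y', h1, h2⟩ := h 0 y (map_zero _) (by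
      rw [map_zero]; exact LinearMap.mem_ker.mp hy1)
    refine ⟨S.pr n x', Submodule.mem_inf.mpr ⟨?_, S.pr_mem n x'⟩, ?_⟩
    · rw [LinearMap.mem_ker, ← S.pr_d, h1, map_zero]
    · have : φ.toLin (S.pr n x') - y = - T.pr n (T.d y') := by
        conv_lhs => rw [← T.pr_same hy2, h2]
        rw [map_add, CDGA.pr_hom]; abel
      rw [this]
      exact Submodule.neg_mem _ (T.pr_d_mem n y')

theorem GradedVS.exists_basis (W : GradedVS) : ∃ (K : Type) (ℓ : K → ℕ)
    (𝒷 : Module.Basis K ℝ W.Ext), (∀ k, 𝒷 k ∈ ⋀[ℝ]^(ℓ k) W.tot) ∧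
      ∀ q, ∀ b ∈ ⋀[ℝ]^q W.tot, ∀ k, ℓ k ≠ q → 𝒷.repr b k = 0 := by
  classical
  let ℬ : ℕ → Submodule ℝ W.Ext := fun i => ⋀[ℝ]^i W.tot
  let : GradedAlgebra ℬ := ExteriorAlgebra.gradedAlgebra ℝ W.tot
  have hinternal : DirectSum.IsInternal ℬ := DirectSum.Decomposition.isInternal ℬ
  refine ⟨_, fun k => k.1, hinternal.collectedBasis (fun i => Module.Basis.ofVectorSpace ℝ (ℬ i)), ?_, ?_⟩
  · intro k
    exact hinternal.collectedBasis_mem _ k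
  · intro q b hb k hk
    obtain ⟨i, k⟩ := k
    exact hinternal.collectedBasis_repr_of_mem_ne _ (Ne.symm hk) hb

theorem CDGA.mem_of_hom (A : CDGA) {M : Type} [AddCommGroup M] [Module ℝ M]
    (T : A.carrier →ₗ[ℝ] M) (Q : Submodule ℝ M) (h : ∀ n, ∀ a ∈ A.grading n, T a ∈ Q)
    (a : A.carrier) : T a ∈ Q := by
  have : (⊤ : Submodule ℝ A.carrier) ≤ Q.comap T := by
    rw [← A.iSup_grading]
    exact iSup_le fun n a ha => h n a ha
  exact this Submodule.mem_top

namespace HMdl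

variable {W : GradedVS} {A : CDGA} (H : HMdl W A)

/-- Filtration by exterior length. -/
def G (p : ℕ) : Submodule ℝ H.E :=
  Submodule.span ℝ {x | ∃ q, q < p ∧ ∃ a : A.carrier, ∃ b ∈ ⋀[ℝ]^q W.tot, x = H.incl a * H.e b}

theorem mem_G {p q : ℕ} (h : q < p) (a : A.carrier) {b : W.Ext} (hb : b ∈ ⋀[ℝ]^q W.tot) :
    H.incl a * H.e b ∈ H.G p := Submodule.subset_span ⟨q, h, a, b, hb, rfl⟩

theorem e_mem_G {p q : ℕ} (h : q < p) {b : W.Ext} (hb : b ∈ ⋀[ℝ]^q W.tot) :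
    H.e b ∈ H.G p := by
  have := H.mem_G h 1 hb
  rwa [map_one, one_mul] at this

theorem incl_mul_G {p : ℕ} (a : A.carrier) {x : H.E} (hx : x ∈ H.G p) : H.incl a * x ∈ H.G p := by
  have : H.G p ≤ (H.G p).comap (LinearMap.mulLeft ℝ (H.incl a)) := by
    refine Submodule.span_le.mpr ?_
    rintro _ ⟨q, hq, a', b, hb, rfl⟩
    show H.incl a * (H.incl a' * H.e b) ∈ H.G p
    rw [← mul_assoc, ← map_mul]
    exact H.mem_G hq _ hb
  exact this hx

theorem ι_mul_mem {i : ℕ} (m : W.tot) {y : W.Ext} (hy : y ∈ ⋀[ℝ]^i W.tot) :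
    ExteriorAlgebra.ι ℝ m * y ∈ ⋀[ℝ]^(i + 1) W.tot := by
  rw [ExteriorAlgebra.exteriorPower, pow_succ']
  exact Submodule.mul_mem_mul (LinearMap.mem_range_self _ m) hy

theorem j_mul_e (n : ℕ) (v : W.V n) (y : W.Ext) : H.j n v * H.e y =
    H.e (ExteriorAlgebra.ι ℝ (DirectSum.lof ℝ ℕ W.V n v) * y) := by
  rw [map_mul, j_apply]

theorem j_mul_G {p : ℕ} (n : ℕ) (v : W.V n) {x : H.E} (hx : x ∈ H.G p) :
    H.j n v * x ∈ H.G (p + 1) := by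
  have : H.G p ≤ (H.G (p + 1)).comap (LinearMap.mulLeft ℝ (H.j n v)) := by
    refine Submodule.span_le.mpr ?_
    rintro _ ⟨q, hq, a, b, hb, rfl⟩
    refine A.mem_of_hom (LinearMap.mulLeft ℝ (H.j n v) ∘ₗ LinearMap.mulRight ℝ (H.e b) ∘ₗ
      H.incl.toLinearMap) (H.G (p + 1)) (fun k a ha => ?_) a
    show H.j n v * (H.incl a * H.e b) ∈ H.G (p + 1)
    have h := H.j_comm k n a v ha
    have h' : H.j n v * H.incl a = ((-1 : ℝ) ^ k) • (H.incl a * H.j n v) := by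
      rw [h, smul_smul, neg_one_sq_pow, one_smul]
    rw [← mul_assoc, h', smul_mul_assoc, mul_assoc, j_mul_e]
    exact Submodule.smul_mem _ _ (H.mem_G (by omega) a (ι_mul_mem _ hb))
  exact this hx

theorem ext_induction {P : ℕ → W.Ext → Prop} (h1 : ∀ r : ℝ, P 0 (r • 1))
    (hadd : ∀ q x y, P q x → P q y → P q (x + y))
    (hmul : ∀ q n (v : W.V n) y, y ∈ ⋀[ℝ]^q W.tot → P q y →
      P (q + 1) (ExteriorAlgebra.ι ℝ (DirectSum.lof ℝ ℕ W.V n v) * y))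
    (q : ℕ) (b : W.Ext) (hb : b ∈ ⋀[ℝ]^q W.tot) : P q b := by
  induction hb using Submodule.pow_induction_on_left' with
  | algebraMap r => rw [Algebra.algebraMap_eq_smul_one]; exact h1 r
  | add _ _ _ _ _ ihx ihy => exact hadd _ _ _ ihx ihy
  | mem_mul m hm i y hy ih =>
      obtain ⟨m, rfl⟩ := hm
      induction m using DirectSum.induction_on with
      | zero =>
          have := hmul i 0 0 y hy ih
          simpa using this
      | of n v => exact hmul i n v y hy ih
      | add m m' h h' =>
          rw [map_add, add_mul]
          exact hadd _ _ _ h h'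

theorem D_e (hW : ∀ n : ℕ, Even n → ∀ v : W.V n, v = 0) (F : VStr W A)
    (q : ℕ) (b : W.Ext) (hb : b ∈ ⋀[ℝ]^q W.tot) : H.D hW F (H.e b) ∈ H.G q := by
  refine ext_induction (P := fun q b => H.D hW F (H.e b) ∈ H.G q) ?_ ?_ ?_ q b hb
  · intro r
    have : H.D hW F 1 = 0 := by
      have := H.D_mul hW F H.one_mem 1
      simpa using this
    rw [map_smul, map_smul, map_one, this, smul_zero]
    exact Submodule.zero_mem _
  · intro q x y hx hy
    rw [map_add, map_add]
    exact Submodule.add_mem _ hx hy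
  · intro q n v y hy ih
    rw [← j_mul_e, H.D_mul hW F (H.j_mem n v), D_j]
    exact Submodule.add_mem _ (H.mem_G (by omega) _ hy)
      (Submodule.smul_mem _ _ (H.j_mul_G n v ih))

theorem D_incl_e (hW : ∀ n : ℕ, Even n → ∀ v : W.V n, v = 0) (F : VStr W A)
    (q : ℕ) (b : W.Ext) (hb : b ∈ ⋀[ℝ]^q W.tot) (a : A.carrier) :
    H.D hW F (H.incl a * H.e b) - H.incl (A.d a) * H.e b ∈ H.G q := by
  refine A.mem_of_hom (H.D hW F ∘ₗ LinearMap.mulRight ℝ (H.e b) ∘ₗ H.incl.toLinearMap -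
    LinearMap.mulRight ℝ (H.e b) ∘ₗ H.incl.toLinearMap ∘ₗ A.d) (H.G q) (fun n a ha => ?_) a
  show H.D hW F (H.incl a * H.e b) - H.incl (A.d a) * H.e b ∈ H.G q
  rw [H.D_mul hW F (H.incl_mem ha), D_incl, add_sub_cancel_left]
  exact Submodule.smul_mem _ _ (H.incl_mul_G a (H.D_e hW F q b hb))

theorem map_e {B : CDGA} (HA : HMdl W A) (HB : HMdl W B) (Ψ : HA.E →ₐ[ℝ] HB.E)
    (c : ∀ n, W.V n → B.carrier) (h2 : ∀ n v, Ψ (HA.j n v) = HB.j n v - HB.incl (c n v))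
    (q : ℕ) (b : W.Ext) (hb : b ∈ ⋀[ℝ]^q W.tot) : Ψ (HA.e b) - HB.e b ∈ HB.G q := by
  refine ext_induction (P := fun q b => Ψ (HA.e b) - HB.e b ∈ HB.G q) ?_ ?_ ?_ q b hb
  · intro r
    simp
  · intro q x y hx hy
    have := Submodule.add_mem _ hx hy
    simp only [map_add]
    convert this using 1
    abel
  · intro q n v y hy ih
    rw [← j_mul_e, ← j_mul_e, map_mul, h2]
    have e : (HB.j n v - HB.incl (c n v)) * Ψ (HA.e y) - HB.j n v * HB.e y =
        HB.j n v * (Ψ (HA.e y) - HB.e y) - HB.incl (c n v) * (Ψ (HA.e y) - HB.e y) -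
          HB.incl (c n v) * HB.e y := by
      noncomm_ring
    have hm : HB.G q ≤ HB.G (q + 1) := by
      refine Submodule.span_mono ?_
      rintro _ ⟨q', hq, h⟩
      exact ⟨q', by omega, h⟩
    rw [e]
    exact Submodule.sub_mem _ (Submodule.sub_mem _ (HB.j_mul_G n v ih)
      (hm (HB.incl_mul_G _ ih))) (HB.mem_G (by omega) _ hy)

/-- Coordinates with respect to a basis of the exterior algebra. -/
def coord {K : Type} (𝒷 : Module.Basis K ℝ W.Ext) : H.E ≃ₗ[ℝ] (K →₀ A.carrier) := by
  classical
  exact (LinearEquiv.ofBijective _ H.bij).symm ≪≫ₗ TensorProduct.equivFinsuppOfBasisRight 𝒷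

theorem coord_mul {K : Type} (𝒷 : Module.Basis K ℝ W.Ext) (a : A.carrier) (b : W.Ext) (k : K) :
    H.coord 𝒷 (H.incl a * H.e b) k = 𝒷.repr b k • a := by
  classical
  have : (LinearEquiv.ofBijective _ H.bij).symm (H.incl a * H.e b) = a ⊗ₜ b := by
    rw [LinearEquiv.symm_apply_eq]
    simp
  unfold coord
  rw [LinearEquiv.trans_apply, this, TensorProduct.equivFinsuppOfBasisRight_apply_tmul_apply]

theorem coord_symm {K : Type} (𝒷 : Module.Basis K ℝ W.Ext) (a : A.carrier) (k : K) :
    (H.coord 𝒷).symm (Finsupp.single k a) = H.incl a * H.e (𝒷 k) := by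
  rw [LinearEquiv.symm_apply_eq]
  ext k'
  rw [coord_mul]
  rw [Module.Basis.repr_self]
  by_cases hk : k = k'
  · subst hk; simp
  · rw [Finsupp.single_eq_of_ne (Ne.symm hk), Finsupp.single_eq_of_ne (Ne.symm hk), zero_smul]

theorem coord_G {K : Type} (𝒷 : Module.Basis K ℝ W.Ext) (ℓ : K → ℕ)
    (h : ∀ q, ∀ b ∈ ⋀[ℝ]^q W.tot, ∀ k, ℓ k ≠ q → 𝒷.repr b k = 0) {p : ℕ} {x : H.E}
    (hx : x ∈ H.G p) : H.coord 𝒷 x ∈ LE' ℓ A.carrier p := by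
  have : H.G p ≤ (LE' ℓ A.carrier p).comap (H.coord 𝒷).toLinearMap := by
    refine Submodule.span_le.mpr ?_
    rintro _ ⟨q, hq, a, b, hb, rfl⟩
    intro k hk
    exact (H.coord_mul 𝒷 a b k).trans (by rw [h q b hb k (by omega), zero_smul])
  exact this hx

theorem acyc_model {B : CDGA} (hW : ∀ n : ℕ, Even n → ∀ v : W.V n, v = 0)
    (FA : VStr W A) (FB : VStr W B) (HA : HMdl W A) (HB : HMdl W B)
    (φ : CDGAHom A B) (hφ : φ.IsQuasiIso) (Ψ : HA.E →ₐ[ℝ] HB.E)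
    (c : ∀ n, W.V n → B.carrier) (h1 : ∀ a, Ψ (HA.incl a) = HB.incl (φ.toLin a))
    (h2 : ∀ n v, Ψ (HA.j n v) = HB.j n v - HB.incl (c n v))
    (h3 : ∀ x, HB.D hW FB (Ψ x) = Ψ (HA.D hW FA x)) :
    Acyc (HA.D hW FA) (HB.D hW FB) Ψ.toLinearMap := by
  obtain ⟨K, ℓ, 𝒷, hb, hr⟩ := W.exists_basis
  let cA := HA.coord 𝒷
  let cB := HB.coord 𝒷
  have key := acyc_filt ℓ A.d B.d φ.toLin hφ.acyc
    (cA.toLinearMap ∘ₗ HA.D hW FA ∘ₗ cA.symm.toLinearMap)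
    (cB.toLinearMap ∘ₗ HB.D hW FB ∘ₗ cB.symm.toLinearMap)
    (cB.toLinearMap ∘ₗ Ψ.toLinearMap ∘ₗ cA.symm.toLinearMap)
    (fun x => by simp [D_D]) (fun x => by simp [D_D]) (fun x => by simp [h3])
    (fun k a => by
      have := HA.coord_G 𝒷 ℓ hr (HA.D_incl_e hW FA (ℓ k) (𝒷 k) (hb k) a)
      rw [map_sub, ← HA.coord_symm 𝒷 (A.d a) k, LinearEquiv.apply_symm_apply,
        ← HA.coord_symm 𝒷 a k] at this
      exact this)
    (fun k a => by
      have := HB.coord_G 𝒷 ℓ hr (HB.D_incl_e hW FB (ℓ k) (𝒷 k) (hb k) a)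
      rw [map_sub, ← HB.coord_symm 𝒷 (B.d a) k, LinearEquiv.apply_symm_apply,
        ← HB.coord_symm 𝒷 a k] at this
      exact this)
    (fun k a => by
      have := HB.coord_G 𝒷 ℓ hr
        (HB.incl_mul_G (φ.toLin a) (map_e HA HB Ψ c h2 (ℓ k) (𝒷 k) (hb k)))
      rw [mul_sub, ← h1, ← map_mul, h1, map_sub, ← HB.coord_symm 𝒷 (φ.toLin a) k,
        LinearEquiv.apply_symm_apply, ← HA.coord_symm 𝒷 a k] at this
      exact this)
  intro x y hx hy
  obtain ⟨x', y', e1, e2⟩ := key (cA x) (cB y) (by simp [hx]) (by simp [hy])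
  refine ⟨cA.symm x', cB.symm y', ?_, ?_⟩
  · apply cA.injective
    exact e1
  · apply cB.injective
    rw [map_add]
    exact e2

end HMdl

/-- Composition of CDGA morphisms. -/
def CDGAHom.comp' {S T U : CDGA} (ψ : CDGAHom T U) (φ : CDGAHom S T) : CDGAHom S U where
  toLin := ψ.toLin ∘ₗ φ.toLin
  map_one := by simp [φ.map_one, ψ.map_one]
  map_mul := by intro a b; simp [φ.map_mul, ψ.map_mul]
  map_grading := fun h => ψ.map_grading (φ.map_grading h)
  map_d := by intro a; simp [φ.map_d, ψ.map_d]

/-- Identity. -/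
def CDGAHom.id' (S : CDGA) : CDGAHom S S where
  toLin := LinearMap.id
  map_one := rfl
  map_mul := fun _ _ => rfl
  map_grading := fun h => h
  map_d := fun _ => rfl

theorem IsHirschExt.inv {W : GradedVS} {A : CDGA} {F : VStr W A} {E E' : CDGA}
    (h : IsHirschExt W F E) (h' : IsHirschExt W F E')
    (Φ : CDGAHom E E') (Φ' : CDGAHom E' E)
    (h1 : ∀ a, Φ.toLin (h.incl.toLin a) = h'.incl.toLin a)
    (h2 : ∀ n v, Φ.toLin (h.j n v) = h'.j n v)
    (h1' : ∀ a, Φ'.toLin (h'.incl.toLin a) = h.incl.toLin a)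
    (h2' : ∀ n v, Φ'.toLin (h'.j n v) = h.j n v) (x : E.carrier) :
    Φ'.toLin (Φ.toLin x) = x := by
  have := (h.universal E h.incl h.j h.j_mem h.dj).unique
    (y₁ := Φ'.comp' Φ) (y₂ := CDGAHom.id' E)
    ⟨fun a => by
      show Φ'.toLin (Φ.toLin _) = _
      rw [h1, h1'], fun n v => by
      show Φ'.toLin (Φ.toLin _) = _
      rw [h2, h2']⟩ ⟨fun _ => rfl, fun _ _ => rfl⟩
  exact congrArg (fun φ : CDGAHom E E => φ.toLin x) this

theorem IsHirschExt.qiso {W : GradedVS} {A : CDGA} {F : VStr W A} {E E' : CDGA}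
    (h : IsHirschExt W F E) (h' : IsHirschExt W F E') : QIso E E' := by
  obtain ⟨Φ, ⟨h1, h2⟩, _⟩ := h.universal E' h'.incl h'.j h'.j_mem h'.dj
  obtain ⟨Φ', ⟨h1', h2'⟩, _⟩ := h'.universal E h.incl h.j h.j_mem h.dj
  refine Relation.EqvGen.rel _ _ ⟨Φ, Acyc.isQuasiIso ?_⟩
  intro x y hx hy
  refine ⟨Φ'.toLin y, 0, ?_, ?_⟩
  · rw [← Φ'.map_d, hy, h.inv h' Φ Φ' h1 h2 h1' h2']
  · rw [h'.inv h Φ' Φ h1' h2' h1 h2, map_zero, add_zero]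

theorem exists_c {W : GradedVS} {S T : CDGA} (φ : CDGAHom S T) (FS : VStr W S) (FT : VStr W T)
    (n : ℕ) (hc : ∀ v : W.V n, φ.Hmap (n + 1) (FS.fsharp n v) = FT.fsharp n v) :
    ∃ c : W.V n →ₗ[ℝ] T.carrier, (∀ v, c v ∈ T.grading n) ∧
      ∀ v, T.d (c v) = FT.f n v - φ.toLin (FS.f n v) := by
  have hm : ∀ v, (FT.f n - φ.toLin ∘ₗ FS.f n) v ∈ (T.grading n).map T.d := by
    intro v
    have h := (hc v).symm
    unfold VStr.fsharp CDGAHom.Hmap at h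
    rw [Submodule.mapQ_apply] at h
    have h2 := (Submodule.Quotient.eq _).mp h
    exact h2
  obtain ⟨s, hs⟩ := LinearMap.exists_rightInverse_of_surjective (T.d.submoduleMap (T.grading n))
    (LinearMap.range_eq_top.mpr (LinearMap.submoduleMap_surjective _ _))
  refine ⟨(T.grading n).subtype ∘ₗ s ∘ₗ
    (FT.f n - φ.toLin ∘ₗ FS.f n).codRestrict _ hm, fun v => (s _).2, fun v => ?_⟩
  have := LinearMap.congr_fun hs ((FT.f n - φ.toLin ∘ₗ FS.f n).codRestrict _ hm v)
  exact congrArg Subtype.val this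

theorem direct_case {W : GradedVS} (hW : ∀ n : ℕ, Even n → ∀ v : W.V n, v = 0)
    {S T : CDGA} (φ : CDGAHom S T) (hφ : φ.IsQuasiIso) (FS : VStr W S) (FT : VStr W T)
    (hc : ∀ n (v : W.V n), φ.Hmap (n + 1) (FS.fsharp n v) = FT.fsharp n v)
    (HA : HMdl W S) (HB : HMdl W T) : QIso (HA.cdga hW FS) (HB.cdga hW FT) := by
  choose c hc1 hc2 using fun n => exists_c φ FS FT n (hc n)
  obtain ⟨Φ, ⟨h1, h2⟩, _⟩ := HA.universal hW FS (HB.cdga hW FT) ((HB.inclHom hW FT).comp' φ)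
    (fun n => HB.j n - HB.incl.toLinearMap ∘ₗ c n)
    (fun n v => Submodule.sub_mem _ (HB.j_mem n v) (HB.incl_mem (hc1 n v)))
    (fun n v => by
      show HB.D hW FT (HB.j n v - HB.incl (c n v)) = HB.incl (φ.toLin (FS.f n v))
      rw [map_sub, HB.D_j, HB.D_incl, hc2, map_sub, sub_sub_cancel])
  refine Relation.EqvGen.rel _ _ ⟨Φ, Acyc.isQuasiIso ?_⟩
  exact HMdl.acyc_model hW FS FT HA HB φ hφ Φ.alg (fun n v => c n v) h1 h2
    (fun x => (Φ.map_d x).symm)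

theorem exists_mid {W : GradedVS} {S T : CDGA} (γ : ∀ n, S.H n →ₗ[ℝ] T.H n) (FS : VStr W S) :
    ∃ FT : VStr W T, ∀ n v, γ (n + 1) (FS.fsharp n v) = FT.fsharp n v := by
  have hs : ∀ n, ∃ s : T.H n →ₗ[ℝ] T.cocycles n, (T.Hsub n).mkQ ∘ₗ s = LinearMap.id := fun n =>
    LinearMap.exists_rightInverse_of_surjective _ (Submodule.range_mkQ _)
  choose s hs using hs
  let fl : ∀ n, W.V n →ₗ[ℝ] S.H (n + 1) := fun n =>
    (S.Hsub (n + 1)).mkQ ∘ₗ (FS.f n).codRestrict (S.cocycles (n + 1)) (fun v =>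
      Submodule.mem_inf.mpr ⟨LinearMap.mem_ker.mpr (FS.f_closed n v), FS.f_mem n v⟩)
  let g : ∀ n, W.V n →ₗ[ℝ] T.cocycles (n + 1) := fun n => s (n + 1) ∘ₗ γ (n + 1) ∘ₗ fl n
  refine ⟨⟨fun n => (T.cocycles (n + 1)).subtype ∘ₗ g n,
    fun n v => (Submodule.mem_inf.mp (g n v).2).2,
    fun n v => LinearMap.mem_ker.mp (Submodule.mem_inf.mp (g n v).2).1⟩, fun n v => ?_⟩
  exact (LinearMap.congr_fun (hs (n + 1)) (γ (n + 1) (fl n v))).symm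

theorem zigzag_case (W : GradedVS) (hW : ∀ n : ℕ, Even n → ∀ v : W.V n, v = 0)
    (A B : CDGA) (γ : ∀ n, A.H n →ₗ[ℝ] B.H n) (hγ : ZigzagInduces A B γ) :
    ∀ (FA : VStr W A) (FB : VStr W B),
    (∀ (n : ℕ) (v : W.V n), γ (n + 1) (FA.fsharp n v) = FB.fsharp n v) →
    ∀ (HA : HMdl W A) (HB : HMdl W B), QIso (HA.cdga hW FA) (HB.cdga hW FB) := by
  induction hγ with
  | direct φ hφ => exact fun FA FB hc HA HB => direct_case hW φ hφ FA FB hc HA HB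
  | symm γ γ' h hl hr ih =>
      intro FA FB hc HA HB
      refine Relation.EqvGen.symm _ _ (ih FB FA (fun n v => ?_) HB HA)
      rw [← hc, hr]
  | trans γ₁ γ₂ _ _ ih₁ ih₂ =>
      intro FA FB hc HA HB
      obtain ⟨FT, hFT⟩ := exists_mid γ₁ FA
      obtain ⟨HT⟩ := HMdl.exists W _
      refine Relation.EqvGen.trans _ _ _ (ih₁ FA FT hFT HA HT) (ih₂ FT FB (fun n v => ?_) HT HB)
      rw [← hFT]
      exact hc n v

theorem main_case (W : GradedVS) (hW : ∀ n : ℕ, Even n → ∀ v : W.V n, v = 0)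
    (A B : CDGA) (FA : VStr W A) (FB : VStr W B)
    (γ : ∀ n, A.H n →ₗ[ℝ] B.H n) (hγ : ZigzagInduces A B γ)
    (hcomp : ∀ (n : ℕ) (v : W.V n), γ (n + 1) (FA.fsharp n v) = FB.fsharp n v)
    (EA EB : CDGA) (hEA : IsHirschExt W FA EA) (hEB : IsHirschExt W FB EB) :
    QIso EA EB := by
  obtain ⟨HA⟩ := HMdl.exists W A
  obtain ⟨HB⟩ := HMdl.exists W B
  exact Relation.EqvGen.trans _ _ _ (hEA.qiso (HA.isHirsch hW FA))
    (Relation.EqvGen.trans _ _ _ (zigzag_case W hW A B γ hγ FA FB hcomp HA HB)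
      ((HB.isHirsch hW FB).qiso hEB))

end HirschProof

/-- if two `V`-CDGAs (with `V` concentrated in odd degrees) are
quasi-isomorphic as CDGAs via a zigzag inducing `γ` in cohomology with
`γ ∘ f_A^♯ = f_B^♯`, then their Hirsch extensions are quasi-isomorphic. -/
theorem statement15 (W : GradedVS) (hW : ∀ n : ℕ, Even n → ∀ v : W.V n, v = 0)
    (A B : CDGA) (FA : VStr W A) (FB : VStr W B)
    (γ : ∀ n, A.H n →ₗ[ℝ] B.H n) (hγ : ZigzagInduces A B γ)
    (hcomp : ∀ (n : ℕ) (v : W.V n), γ (n + 1) (FA.fsharp n v) = FB.fsharp n v)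
    (EA EB : CDGA) (hEA : IsHirschExt W FA EA) (hEB : IsHirschExt W FB EB) :
    QIso EA EB := by
  exact main_case W hW A B FA FB γ hγ hcomp EA EB hEA hEB
end
end

section
/- Let V be a graded vector space concentrated in odd degrees and (A, d, f) a V-CDGA such that (A, d) is a formal CDGA. Then the Hirsch extension (A ⊗ ∧V, d_f) is quasi-isomorphic to (H*(A) ⊗ ∧V, d_{f^#}). -/
open scoped Manifold

noncomputable section

namespace Hirsch
open scoped TensorProduct DirectSum

/-! ### Generalities on CDGAs -/

instance gAlg (A : CDGA) : GradedAlgebra A.grading :=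
  { one_mem := A.one_mem
    mul_mem := fun _ _ _ _ ha hb => A.mul_mem ha hb
    toDecomposition := A.internal.chooseDecomposition }

theorem cdga_ind (A : CDGA) {P : A.carrier → Prop} (h0 : P 0)
    (hh : ∀ n, ∀ a ∈ A.grading n, P a) (hadd : ∀ a b, P a → P b → P (a + b)) (a : A.carrier) :
    P a := by
  induction a using DirectSum.Decomposition.inductionOn A.grading with
  | zero => exact h0
  | homogeneous m => exact hh _ _ m.2
  | add _ _ h1 h2 => exact hadd _ _ h1 h2

/-- The projection to degree `n`. -/
def proj (A : CDGA) (n : ℕ) : A.carrier →ₗ[ℝ] A.carrier := GradedAlgebra.proj A.grading n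

theorem proj_mem (A : CDGA) (n : ℕ) (a : A.carrier) : proj A n a ∈ A.grading n := by
  simp [proj, GradedAlgebra.proj_apply]

theorem proj_same (A : CDGA) {n : ℕ} {a : A.carrier} (h : a ∈ A.grading n) : proj A n a = a := by
  simp [proj, GradedAlgebra.proj_apply, DirectSum.decompose_of_mem_same _ h]

theorem proj_ne (A : CDGA) {m n : ℕ} {a : A.carrier} (h : a ∈ A.grading m) (hmn : m ≠ n) :
    proj A n a = 0 := by
  simp [proj, GradedAlgebra.proj_apply, DirectSum.decompose_of_mem_ne _ h hmn]

theorem proj_d (A : CDGA) (n : ℕ) (a : A.carrier) : proj A (n + 1) (A.d a) = A.d (proj A n a) := by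
  induction a using cdga_ind with
  | h0 => simp
  | hh m a ha =>
    by_cases hmn : m = n
    · subst hmn
      rw [proj_same A ha, proj_same A (A.d_mem ha)]
    · rw [proj_ne A ha hmn, proj_ne A (A.d_mem ha) (by omega), map_zero]
  | hadd a b h1 h2 => simp [h1, h2]

theorem proj_zero_d (A : CDGA) (a : A.carrier) : proj A 0 (A.d a) = 0 := by
  induction a using cdga_ind with
  | h0 => simp
  | hh m a ha => exact proj_ne A (A.d_mem ha) (by omega)
  | hadd a b h1 h2 => simp [h1, h2]

theorem proj_hom {S T : CDGA} (φ : CDGAHom S T) (n : ℕ) (a : S.carrier) :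
    proj T n (φ.toLin a) = φ.toLin (proj S n a) := by
  induction a using cdga_ind with
  | h0 => simp
  | hh m a ha =>
    by_cases hmn : m = n
    · subst hmn
      rw [proj_same _ ha, proj_same _ (φ.map_grading ha)]
    · rw [proj_ne _ ha hmn, proj_ne _ (φ.map_grading ha) hmn, map_zero]
  | hadd a b h1 h2 => simp [h1, h2]

theorem exists_sum_proj (A : CDGA) (a : A.carrier) :
    ∃ N : ℕ, ∀ M, N ≤ M → ∑ n ∈ Finset.range M, proj A n a = a := by
  induction a using cdga_ind with
  | h0 => exact ⟨0, by simp⟩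
  | hh m a ha =>
    refine ⟨m + 1, fun M hM => ?_⟩
    rw [Finset.sum_eq_single m]
    · exact proj_same A ha
    · intro b _ hb
      exact proj_ne A ha (Ne.symm hb)
    · intro h
      simp at h
      omega
  | hadd a b h1 h2 =>
    obtain ⟨N1, h1⟩ := h1
    obtain ⟨N2, h2⟩ := h2
    refine ⟨max N1 N2, fun M hM => ?_⟩
    simp only [map_add, Finset.sum_add_distrib]
    rw [h1 M (le_trans (le_max_left _ _) hM), h2 M (le_trans (le_max_right _ _) hM)]

/-- Acyclicity of the mapping cone, ignoring gradings. -/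
def ConeAcyclic {S T : CDGA} (φ : CDGAHom S T) : Prop :=
  ∀ (x : S.carrier) (y : T.carrier), S.d x = 0 → φ.toLin x = T.d y →
    ∃ (x' : S.carrier) (y' : T.carrier), S.d x' = x ∧ φ.toLin x' - y = T.d y'

theorem mem_cob_of_d {S : CDGA} {n : ℕ} {x x' : S.carrier} (hx : x ∈ S.grading n)
    (h : S.d x' = x) : x ∈ S.coboundaries n := by
  rw [← proj_same S hx, ← h]
  cases n with
  | zero => rw [proj_zero_d]; exact Submodule.zero_mem _
  | succ n =>
    rw [proj_d]
    exact ⟨_, proj_mem S n x', rfl⟩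

theorem d_of_mem_cob {S : CDGA} {n : ℕ} {x : S.carrier} (h : x ∈ S.coboundaries n) :
    ∃ x', S.d x' = x := by
  cases n with
  | zero => exact ⟨0, by rw [map_zero]; exact ((Submodule.mem_bot ℝ).1 h).symm⟩
  | succ n =>
    obtain ⟨b, _, hb⟩ := h
    exact ⟨b, hb⟩

theorem mem_cocycles {S : CDGA} {n : ℕ} {x : S.carrier} :
    x ∈ S.cocycles n ↔ S.d x = 0 ∧ x ∈ S.grading n := by
  simp [CDGA.cocycles]

theorem quasiIso_of_cone {S T : CDGA} (φ : CDGAHom S T) (h : ConeAcyclic φ) : φ.IsQuasiIso := by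
  intro n
  constructor
  · intro x hx hc
    obtain ⟨hd, hg⟩ := mem_cocycles.1 hx
    obtain ⟨y, hy⟩ := d_of_mem_cob hc
    obtain ⟨x', _, hx', _⟩ := h x y hd hy.symm
    exact mem_cob_of_d hg hx'
  · intro y hy
    obtain ⟨hd, hg⟩ := mem_cocycles.1 hy
    obtain ⟨x', y', hx', hy'⟩ := h 0 y (map_zero _) (by rw [map_zero, hd])
    refine ⟨proj S n x', mem_cocycles.2 ⟨?_, proj_mem _ _ _⟩, ?_⟩
    · rw [← proj_d, hx', map_zero]
    · have : φ.toLin (proj S n x') - y = proj T n (T.d y') := by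
        rw [← hy', map_sub, proj_hom, proj_same T hg]
      rw [this]
      cases n with
      | zero => rw [proj_zero_d]; exact Submodule.zero_mem _
      | succ n =>
        rw [proj_d]
        exact ⟨_, proj_mem _ _ _, rfl⟩

theorem cone_of_quasiIso {S T : CDGA} (φ : CDGAHom S T) (h : φ.IsQuasiIso) : ConeAcyclic φ := by
  -- homogeneous version
  have key : ∀ (n : ℕ) (x : S.carrier) (y : T.carrier), x ∈ S.grading (n + 1) →
      y ∈ T.grading n → S.d x = 0 → φ.toLin x = T.d y →
      ∃ (x' : S.carrier) (y' : T.carrier), S.d x' = x ∧ φ.toLin x' - y = T.d y' := by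
    intro n x y hx hy hdx hxy
    have h1 := (h (n + 1)).1 x (mem_cocycles.2 ⟨hdx, hx⟩) ⟨y, hy, hxy.symm⟩
    obtain ⟨b, hb, hdb⟩ := h1
    obtain ⟨c, hc, hcc⟩ := (h n).2 (φ.toLin b - y) (mem_cocycles.2 ⟨by
      rw [map_sub, ← φ.map_d, hdb, hxy, sub_self],
      Submodule.sub_mem _ (φ.map_grading hb) hy⟩)
    obtain ⟨z, hz⟩ := d_of_mem_cob hcc
    refine ⟨b - c, -z, ?_, ?_⟩
    · rw [map_sub, hdb, (mem_cocycles.1 hc).1, sub_zero]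
    · rw [map_neg, hz, map_sub]; abel
  intro x y hdx hxy
  have hk : ∀ n, ∃ (x' : S.carrier) (y' : T.carrier), S.d x' = proj S (n + 1) x ∧
      φ.toLin x' - proj T n y = T.d y' := fun n =>
    key n _ _ (proj_mem _ _ _) (proj_mem _ _ _) (by rw [← proj_d, hdx, map_zero])
      (by rw [← proj_hom, hxy, proj_d])
  choose f g hf hg using hk
  obtain ⟨N1, h1⟩ := exists_sum_proj S x
  obtain ⟨N2, h2⟩ := exists_sum_proj T y
  have h0 : proj S 0 x = 0 := by
    have := (h 0).1 (proj S 0 x) (mem_cocycles.2 ⟨by rw [← proj_d, hdx, map_zero],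
      proj_mem _ _ _⟩) (by rw [← proj_hom, hxy, proj_zero_d]; exact Submodule.zero_mem _)
    exact (Submodule.mem_bot ℝ).1 this
  set M := max N1 N2
  refine ⟨∑ n ∈ Finset.range M, f n, ∑ n ∈ Finset.range M, g n, ?_, ?_⟩
  · rw [map_sum]
    simp only [hf]
    have := h1 (M + 1) (le_trans (le_max_left _ _) (Nat.le_succ _))
    rw [Finset.sum_range_succ', h0, add_zero] at this
    exact this
  · rw [map_sum, map_sum]
    simp only [← hg]
    rw [Finset.sum_sub_distrib, h2 M (le_max_right _ _)]

/-! ### Identity, composition, isomorphisms -/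

theorem hom_ext {S T : CDGA} {f g : CDGAHom S T} (h : ∀ x, f.toLin x = g.toLin x) : f = g := by
  cases f; cases g
  congr
  exact LinearMap.ext h

def idHom (S : CDGA) : CDGAHom S S where
  toLin := LinearMap.id
  map_one := rfl
  map_mul _ _ := rfl
  map_grading h := h
  map_d _ := rfl

def compHom {S T U : CDGA} (g : CDGAHom T U) (f : CDGAHom S T) : CDGAHom S U where
  toLin := g.toLin ∘ₗ f.toLin
  map_one := by simp [f.map_one, g.map_one]
  map_mul a b := by simp [f.map_mul, g.map_mul]
  map_grading h := g.map_grading (f.map_grading h)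
  map_d a := by simp [f.map_d, g.map_d]

theorem quasiIso_of_inverse {S T : CDGA} (f : CDGAHom S T) (g : CDGAHom T S)
    (h1 : ∀ x, g.toLin (f.toLin x) = x) (h2 : ∀ y, f.toLin (g.toLin y) = y) : f.IsQuasiIso := by
  apply quasiIso_of_cone
  intro x y _ hxy
  refine ⟨g.toLin y, 0, ?_, ?_⟩
  · rw [← g.map_d, ← hxy, h1]
  · rw [h2, sub_self, map_zero]

/-- Cohomologous `V`-structures have isomorphic Hirsch extensions. -/
theorem directQIso_of_cohomologous {W : GradedVS} {A : CDGA} (F F' : VStr W A)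
    (h : ∀ n, W.V n →ₗ[ℝ] A.carrier) (hmem : ∀ n v, h n v ∈ A.grading n)
    (hd : ∀ n v, A.d (h n v) = F.f n v - F'.f n v)
    (E E' : CDGA) (hE : IsHirschExt W F E) (hE' : IsHirschExt W F' E') : DirectQIso E E' := by
  obtain ⟨Φ, ⟨hΦ1, hΦ2⟩, _⟩ := hE.universal E' hE'.incl
    (fun n => hE'.j n + hE'.incl.toLin ∘ₗ h n)
    (fun n v => Submodule.add_mem _ (hE'.j_mem n v) (hE'.incl.map_grading (hmem n v)))
    (fun n v => by
      simp only [LinearMap.add_apply, LinearMap.comp_apply, map_add, hE'.dj, ← CDGAHom.map_d, hd,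
        map_sub]; abel)
  obtain ⟨Ψ, ⟨hΨ1, hΨ2⟩, _⟩ := hE'.universal E hE.incl
    (fun n => hE.j n - hE.incl.toLin ∘ₗ h n)
    (fun n v => Submodule.sub_mem _ (hE.j_mem n v) (hE.incl.map_grading (hmem n v)))
    (fun n v => by
      simp only [LinearMap.sub_apply, LinearMap.comp_apply, map_sub, hE.dj, ← CDGAHom.map_d, hd]
      abel)
  refine ⟨Φ, quasiIso_of_inverse Φ Ψ ?_ ?_⟩
  · obtain ⟨u, _, hu⟩ := hE.universal E hE.incl hE.j hE.j_mem hE.dj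
    have e1 := hu (compHom Ψ Φ) ⟨fun a => by simp [compHom, hΦ1, hΨ1],
      fun n v => by simp [compHom, hΦ2, hΨ1, hΨ2]⟩
    have e2 := hu (idHom E) ⟨fun a => rfl, fun n v => rfl⟩
    intro x
    have := congrArg (fun q => q.toLin x) (e1.trans e2.symm)
    exact this
  · obtain ⟨u, _, hu⟩ := hE'.universal E' hE'.incl hE'.j hE'.j_mem hE'.dj
    have e1 := hu (compHom Φ Ψ) ⟨fun a => by simp [compHom, hΦ1, hΨ1],
      fun n v => by simp [compHom, hΦ1, hΦ2, hΨ2]⟩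
    have e2 := hu (idHom E') ⟨fun a => rfl, fun n v => rfl⟩
    intro x
    have := congrArg (fun q => q.toLin x) (e1.trans e2.symm)
    exact this

/-! ### Scaling automorphisms of a CDGA -/

/-- The algebra endomorphism multiplying degree `n` by `c ^ n`. -/
def scaleLin (A : CDGA) (c : ℝ) : A.carrier →ₗ[ℝ] A.carrier :=
  DirectSum.toModule ℝ ℕ A.carrier (fun n => (c ^ n) • (A.grading n).subtype) ∘ₗ
    (DirectSum.decomposeLinearEquiv A.grading).toLinearMap

theorem scaleLin_mem (A : CDGA) (c : ℝ) {n : ℕ} {a : A.carrier} (h : a ∈ A.grading n) :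
    scaleLin A c a = c ^ n • a := by
  simp only [scaleLin, LinearMap.comp_apply, LinearEquiv.coe_coe,
    DirectSum.decomposeLinearEquiv_apply, DirectSum.decompose_of_mem _ h]
  rw [← DirectSum.lof_eq_of ℝ, DirectSum.toModule_lof]
  rfl

theorem scaleLin_mul (A : CDGA) (c : ℝ) (a b : A.carrier) :
    scaleLin A c (a * b) = scaleLin A c a * scaleLin A c b := by
  induction a using cdga_ind with
  | h0 => simp
  | hh m a ha =>
    induction b using cdga_ind with
    | h0 => simp
    | hh n b hb =>
      rw [scaleLin_mem A c ha, scaleLin_mem A c hb, scaleLin_mem A c (A.mul_mem ha hb), pow_add,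
        smul_mul_smul_comm]
    | hadd a b h1 h2 => simp only [mul_add, map_add, h1, h2]
  | hadd a b h1 h2 => simp only [add_mul, map_add, h1, h2]

def scale (A : CDGA) (c : ℝ) : A.carrier →ₐ[ℝ] A.carrier :=
  AlgHom.ofLinearMap (scaleLin A c) (by simp [scaleLin_mem A c A.one_mem]) (scaleLin_mul A c)

theorem scale_mem (A : CDGA) (c : ℝ) {n : ℕ} {a : A.carrier} (h : a ∈ A.grading n) :
    scale A c a = c ^ n • a := scaleLin_mem A c h

theorem leibniz_scale (A : CDGA) (a b : A.carrier) :
    A.d (a * b) = A.d a * b + scale A (-1) a * A.d b := by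
  induction a using cdga_ind with
  | h0 => simp
  | hh m a ha => rw [A.leibniz ha, scale_mem A _ ha, smul_mul_assoc]
  | hadd a a' h1 h2 => simp only [add_mul, map_add, h1, h2]; abel

end Hirsch


namespace Hirsch
open scoped TensorProduct DirectSum

/-! ### The graded tensor product `A ⊗ ∧V` -/

section model
variable (A : CDGA) (V : Type) [AddCommGroup V] [Module ℝ V]

/-- `A ⊗ ∧V` -/
def HE : Type := GradedTensorProduct ℝ A.grading (fun i : ℕ => ⋀[ℝ]^i V)

instance : Ring (HE A V) :=
  inferInstanceAs (Ring (GradedTensorProduct ℝ A.grading (fun i : ℕ => ⋀[ℝ]^i V)))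

instance : Algebra ℝ (HE A V) :=
  inferInstanceAs (Algebra ℝ (GradedTensorProduct ℝ A.grading (fun i : ℕ => ⋀[ℝ]^i V)))

def iH : A.carrier →ₐ[ℝ] HE A V :=
  GradedTensorProduct.includeLeft A.grading (fun i : ℕ => ⋀[ℝ]^i V)

def rH : ExteriorAlgebra ℝ V →ₐ[ℝ] HE A V :=
  GradedTensorProduct.includeRight A.grading (fun i : ℕ => ⋀[ℝ]^i V)

def tH : A.carrier ⊗[ℝ] ExteriorAlgebra ℝ V ≃ₗ[ℝ] HE A V :=
  GradedTensorProduct.of ℝ A.grading (fun i : ℕ => ⋀[ℝ]^i V)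

def yH : V →ₗ[ℝ] HE A V := (rH A V).toLinearMap ∘ₗ ExteriorAlgebra.ι ℝ

theorem tH_tmul (a : A.carrier) (w : ExteriorAlgebra ℝ V) :
    tH A V (a ⊗ₜ w) = iH A V a * rH A V w :=
  (GradedTensorProduct.tmul_one_mul_one_tmul A.grading (fun i : ℕ => ⋀[ℝ]^i V) a w).symm

theorem yH_sq (v : V) : yH A V v * yH A V v = 0 := by
  simp only [yH, LinearMap.comp_apply, AlgHom.toLinearMap_apply, ← map_mul,
    ExteriorAlgebra.ι_sq_zero, map_zero]

theorem yH_anti (v w : V) : yH A V v * yH A V w = - (yH A V w * yH A V v) := by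
  have := yH_sq A V (v + w)
  simp only [map_add, mul_add, add_mul, yH_sq, zero_add, add_zero] at this
  rw [eq_neg_iff_add_eq_zero, add_comm]
  exact this

theorem yH_iH (v : V) (a : A.carrier) :
    yH A V v * iH A V a = iH A V (scale A (-1) a) * yH A V v := by
  induction a using cdga_ind with
  | h0 => simp
  | hadd a b h1 h2 => simp only [map_add, mul_add, add_mul, h1, h2]
  | hh n a ha =>
    have hv : ExteriorAlgebra.ι ℝ v ∈ ⋀[ℝ]^1 V := by
      simpa only [pow_one] using LinearMap.mem_range_self _ v
    have h := GradedTensorProduct.tmul_coe_mul_coe_tmul (R := ℝ) A.grading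
      (fun i : ℕ => ⋀[ℝ]^i V) 1 ⟨_, hv⟩ ⟨a, ha⟩ 1
    rw [scale_mem A _ ha, map_smul, smul_mul_assoc]
    have h2 := tH_tmul A V a (ExteriorAlgebra.ι ℝ v)
    simp only [one_mul, mul_one] at h
    have h3 : yH A V v * iH A V a = (-1 : ℝ) ^ n • tH A V (a ⊗ₜ ExteriorAlgebra.ι ℝ v) := by
      rcases Nat.even_or_odd n with hn | hn
      · rw [show (-1 : ℤˣ) ^ n = 1 from hn.neg_one_pow, one_smul] at h
        rw [show (-1 : ℝ) ^ n = 1 from hn.neg_one_pow, one_smul]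
        exact h
      · rw [show (-1 : ℤˣ) ^ n = -1 from hn.neg_one_pow, Units.neg_smul, one_smul] at h
        rw [show (-1 : ℝ) ^ n = -1 from hn.neg_one_pow, neg_one_smul]
        exact h
    rw [h3, h2]
    rfl

variable {A V}

theorem HE_lift {C : Type} [Ring C] [Algebra ℝ C] (g : A.carrier →ₐ[ℝ] C) (h : V →ₗ[ℝ] C)
    (hsq : ∀ v, h v * h v = 0)
    (hcomm : ∀ v n, ∀ a ∈ A.grading n, h v * g a = (-1 : ℝ) ^ n • (g a * h v)) :
    ∃ Φ : HE A V →ₐ[ℝ] C, (∀ a, Φ (iH A V a) = g a) ∧ ∀ v, Φ (yH A V v) = h v := by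
  let hL : ExteriorAlgebra ℝ V →ₐ[ℝ] C := ExteriorAlgebra.lift ℝ ⟨h, hsq⟩
  have key : ∀ (i : ℕ) (a : A.carrier), a ∈ A.grading i → ∀ (j : ℕ) (w : ExteriorAlgebra ℝ V),
      w ∈ ⋀[ℝ]^j V → hL w * g a = (-1 : ℝ) ^ (j * i) • (g a * hL w) := by
    intro i a ha j w hw
    induction hw using Submodule.pow_induction_on_left' with
    | algebraMap r => 
      simp only [AlgHom.commutes, zero_mul, pow_zero, one_smul]
      exact Algebra.commutes _ _
    | add x y i _ _ h1 h2 => simp only [map_add, add_mul, mul_add, smul_add, h1, h2]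
    | mem_mul m hm j x _ ih =>
      obtain ⟨v, rfl⟩ := hm
      have e : hL (ExteriorAlgebra.ι ℝ v) = h v := ExteriorAlgebra.lift_ι_apply _ _ _ _
      rw [map_mul, mul_assoc, ih, mul_smul_comm, ← mul_assoc, e, hcomm v i a ha, smul_mul_assoc,
        smul_smul, mul_assoc, Nat.succ_mul, pow_add]
  refine ⟨GradedTensorProduct.lift A.grading (fun i : ℕ => ⋀[ℝ]^i V) g hL ?_, ?_, ?_⟩
  · intro i j a b
    rw [key i a a.2 j b b.2]
    rcases Nat.even_or_odd (j * i) with hn | hn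
    · rw [show (-1 : ℤˣ) ^ (j * i) = 1 from hn.neg_one_pow, one_smul, hn.neg_one_pow, one_smul]
    · rw [show (-1 : ℤˣ) ^ (j * i) = -1 from hn.neg_one_pow, hn.neg_one_pow, Units.neg_smul,
        one_smul, neg_one_smul, neg_neg]
  · intro a
    refine (GradedTensorProduct.lift_tmul A.grading (fun i : ℕ => ⋀[ℝ]^i V) g hL _ a 1).trans ?_
    rw [map_one, mul_one]
  · intro v
    refine (GradedTensorProduct.lift_tmul A.grading (fun i : ℕ => ⋀[ℝ]^i V) g hL _ 1
      (ExteriorAlgebra.ι ℝ v)).trans ?_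
    rw [map_one, one_mul]
    exact ExteriorAlgebra.lift_ι_apply _ _ _ _

end model
end Hirsch


namespace Hirsch
open scoped TensorProduct DirectSum

/-! ### The model of the Hirsch extension -/

theorem scale_scale (A : CDGA) (a : A.carrier) : scale A (-1) (scale A (-1) a) = a := by
  induction a using cdga_ind with
  | h0 => simp
  | hadd a b h1 h2 => simp only [map_add, h1, h2]
  | hh n a ha =>
    rw [scale_mem A _ ha, map_smul, scale_mem A _ ha, smul_smul, ← mul_pow]
    simp

theorem HE_ind_aux {A : CDGA} {V : Type} [AddCommGroup V] [Module ℝ V] {P : HE A V → Prop}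
    (hadd : ∀ x y, P x → P y → P (x + y))
    (hi : ∀ a, P (iH A V a)) (hy : ∀ v x, P x → P (yH A V v * x)) (x : HE A V) : P x := by
  obtain ⟨t, rfl⟩ := (tH A V).surjective x
  induction t using TensorProduct.induction_on with
  | zero => simpa using hi 0
  | add x y h1 h2 => rw [map_add]; exact hadd _ _ h1 h2
  | tmul a w =>
    rw [tH_tmul]
    induction w using DirectSum.Decomposition.inductionOn (fun i : ℕ => ⋀[ℝ]^i V) with
    | zero => simpa using hi 0
    | add x y h1 h2 => rw [map_add, mul_add]; exact hadd _ _ h1 h2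
    | homogeneous m =>
      obtain ⟨w, hw⟩ := m
      change P (iH A V a * rH A V w)
      induction hw using Submodule.pow_induction_on_left' generalizing a with
      | algebraMap r =>
        rw [AlgHom.commutes, ← (iH A V).commutes r, ← map_mul]
        exact hi _
      | add x y i _ _ h1 h2 => rw [map_add, mul_add]; exact hadd _ _ (h1 a) (h2 a)
      | mem_mul m hm j x _ ih =>
        obtain ⟨v, rfl⟩ := hm
        have := yH_iH A V v (scale A (-1) a)
        rw [scale_scale] at this
        rw [map_mul, ← mul_assoc]
        change P (iH A V a * yH A V v * _)
        rw [← this, mul_assoc]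
        exact hy _ _ (ih _)

section
variable (W : GradedVS) (A : CDGA)

/-- The total space of a graded vector space. -/
abbrev Tot : Type := ⨁ n, W.V n

/-- The generator of the model attached to `v`. -/
def yy (n : ℕ) : W.V n →ₗ[ℝ] HE A (Tot W) :=
  yH A (Tot W) ∘ₗ DirectSum.lof ℝ ℕ W.V n

abbrev ii : A.carrier →ₐ[ℝ] HE A (Tot W) := iH A (Tot W)

variable {W A}

theorem tot_ind {P : Tot W → Prop} (h0 : P 0) (hadd : ∀ x y, P x → P y → P (x + y))
    (hs : ∀ n v, P (DirectSum.lof ℝ ℕ W.V n v)) (v : Tot W) : P v := by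
  induction v using DirectSum.induction_on with
  | zero => exact h0
  | of n v => exact hs n v
  | add x y h1 h2 => exact hadd _ _ h1 h2

/-- Induction principle for the model. -/
theorem HE_ind (hW : ∀ n : ℕ, Even n → ∀ v : W.V n, v = 0) {P : HE A (Tot W) → Prop}
    (hadd : ∀ x y, P x → P y → P (x + y))
    (hi : ∀ n, ∀ a ∈ A.grading n, P (ii W A a))
    (hy : ∀ n v x, Odd n → P x → P (yy W A n v * x)) (x : HE A (Tot W)) : P x := by
  have h0 : P 0 := by simpa using hi 0 0 (Submodule.zero_mem _)
  refine HE_ind_aux hadd ?_ ?_ x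
  · intro a
    induction a using cdga_ind with
    | h0 => simpa using h0
    | hh n a ha => exact hi n a ha
    | hadd a b h1 h2 => rw [map_add]; exact hadd _ _ h1 h2
  · intro v x hx
    induction v using tot_ind with
    | h0 => simpa using h0
    | hadd v w h1 h2 => rw [map_add, add_mul]; exact hadd _ _ h1 h2
    | hs n v =>
      rcases Nat.even_or_odd n with hn | hn
      · rw [hW n hn v]; simpa using h0
      · exact hy n v x hn hx

theorem yy_anti (m n : ℕ) (v : W.V m) (w : W.V n) :
    yy W A m v * yy W A n w = - (yy W A n w * yy W A m v) := yH_anti _ _ _ _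

theorem yy_ii (n : ℕ) (v : W.V n) (a : A.carrier) :
    yy W A n v * ii W A a = ii W A (scale A (-1) a) * yy W A n v := yH_iH _ _ _ _

theorem yy_ii_mem (n : ℕ) (v : W.V n) {m : ℕ} {a : A.carrier} (ha : a ∈ A.grading m) :
    yy W A n v * ii W A a = (-1 : ℝ) ^ m • (ii W A a * yy W A n v) := by
  rw [yy_ii, scale_mem A _ ha, map_smul, smul_mul_assoc]

/-! #### The differential -/

/-- The total map `V → A`. -/
def ftot (F : VStr W A) : Tot W →ₗ[ℝ] A.carrier := DirectSum.toModule ℝ ℕ A.carrier F.f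

theorem ftot_lof (F : VStr W A) (n : ℕ) (v : W.V n) :
    ftot F (DirectSum.lof ℝ ℕ W.V n v) = F.f n v := DirectSum.toModule_lof _ _ _

theorem scale_ftot (hW : ∀ n : ℕ, Even n → ∀ v : W.V n, v = 0) (F : VStr W A) (v : Tot W) :
    scale A (-1) (ftot F v) = ftot F v := by
  induction v using tot_ind with
  | h0 => simp
  | hadd v w h1 h2 => simp only [map_add, h1, h2]
  | hs n v =>
    rw [ftot_lof]
    rcases Nat.even_or_odd n with hn | hn
    · rw [hW n hn v]; simp
    · rw [scale_mem A _ (F.f_mem n v), (hn.add_one).neg_one_pow, one_smul]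

theorem ftot_comm (hW : ∀ n : ℕ, Even n → ∀ v : W.V n, v = 0) (F : VStr W A) (v : Tot W)
    (a : A.carrier) : ftot F v * a = a * ftot F v := by
  induction v using tot_ind with
  | h0 => simp
  | hadd v w h1 h2 => simp only [map_add, add_mul, mul_add, h1, h2]
  | hs n v =>
    rw [ftot_lof]
    rcases Nat.even_or_odd n with hn | hn
    · rw [hW n hn v]; simp
    · induction a using cdga_ind with
      | h0 => simp
      | hadd a b h1 h2 => simp only [add_mul, mul_add, h1, h2]
      | hh m a ha =>
        rw [A.gcomm (F.f_mem n v) ha, (hn.add_one.mul_right m).neg_one_pow, one_smul]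

/-- The map `a ↦ [[σ a, d a], [0, a]]`. -/
def matA (A : CDGA) (V : Type) [AddCommGroup V] [Module ℝ V] :
    A.carrier →ₐ[ℝ] Matrix (Fin 2) (Fin 2) (HE A V) :=
  AlgHom.ofLinearMap
    { toFun := fun a => !![iH A V (scale A (-1) a), iH A V (A.d a); 0, iH A V a]
      map_add' := by
        intro a b
        ext i j
        fin_cases i <;> fin_cases j <;> simp
      map_smul' := by
        intro c a
        ext i j
        fin_cases i <;> fin_cases j <;> simp }
    (by
      have h1 : A.d 1 = 0 := by
        have := leibniz_scale A 1 1
        simpa using this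
      ext i j
      fin_cases i <;> fin_cases j <;> simp [h1])
    (by
      intro a b
      ext i j
      fin_cases i <;> fin_cases j <;>
        simp [Matrix.mul_apply, Fin.sum_univ_two, leibniz_scale, add_comm])

/-- The map `v ↦ [[-v, f v], [0, v]]`. -/
def matV (F : VStr W A) : Tot W →ₗ[ℝ] Matrix (Fin 2) (Fin 2) (HE A (Tot W)) where
  toFun := fun v => !![-yH A (Tot W) v, ii W A (ftot F v); 0, yH A (Tot W) v]
  map_add' := by
    intro a b
    ext i j
    fin_cases i <;> fin_cases j <;> simp [add_comm]
  map_smul' := by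
    intro c a
    ext i j
    fin_cases i <;> fin_cases j <;> simp

theorem exists_dH (hW : ∀ n : ℕ, Even n → ∀ v : W.V n, v = 0) (F : VStr W A) :
    ∃ d : HE A (Tot W) →ₗ[ℝ] HE A (Tot W),
      (∀ a, d (ii W A a) = ii W A (A.d a)) ∧
      (∀ a x, d (ii W A a * x) = ii W A (A.d a) * x + ii W A (scale A (-1) a) * d x) ∧
      (∀ n v, d (yy W A n v) = ii W A (F.f n v)) ∧
      (∀ n v x, d (yy W A n v * x) = ii W A (F.f n v) * x - yy W A n v * d x) := by
  obtain ⟨Φ, hΦ1, hΦ2⟩ := HE_lift (matA A (Tot W)) (matV F) (by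
    intro v
    ext i j
    have h1 := yH_sq A (Tot W) v
    have h2 := yH_iH A (Tot W) v (ftot F v)
    rw [scale_ftot hW] at h2
    fin_cases i <;> fin_cases j <;>
        simp [matV, Matrix.mul_apply, Fin.sum_univ_two, h1, h2]) (by
    intro v n a ha
    have h1 := yH_iH A (Tot W) v a
    have h2 := yH_iH A (Tot W) v (scale A (-1) a)
    have h3 := yH_iH A (Tot W) v (A.d a)
    have h4 : iH A (Tot W) (ftot F v) * iH A (Tot W) a = iH A (Tot W) a * iH A (Tot W) (ftot F v) := by
      rw [← map_mul, ftot_comm hW, map_mul]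
    rw [scale_mem A _ ha] at h1 h2
    rw [scale_mem A _ (A.d_mem ha)] at h3
    have hs : ((-1 : ℝ) ^ n) * (-1) ^ n = 1 := by rw [← mul_pow]; simp
    simp only [map_smul, smul_mul_assoc, mul_smul_comm] at h1 h2 h3
    ext i j
    fin_cases i <;> fin_cases j
    · simp [matV, matA, Matrix.mul_apply, Fin.sum_univ_two, scale_mem A _ ha, h1, smul_smul, hs]
    · simp [matV, matA, Matrix.mul_apply, Fin.sum_univ_two, scale_mem A _ ha, h3, h4, smul_smul,
        hs, pow_succ]
      abel
    · simp [matV, matA, Matrix.mul_apply, Fin.sum_univ_two]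
    · simp [matV, matA, Matrix.mul_apply, Fin.sum_univ_two, h1])
  have h11 : ∀ x, Φ x 1 1 = x := by
    intro x
    induction x using HE_ind_aux with
    | hadd x y h1 h2 => rw [map_add, Matrix.add_apply, h1, h2]
    | hi a => rw [hΦ1]; simp [matA]
    | hy v x hx =>
      rw [map_mul, Matrix.mul_apply, Fin.sum_univ_two, hx, hΦ2]
      simp [matV]
  have hy : ∀ n v, Φ (yy W A n v) = matV F (DirectSum.lof ℝ ℕ W.V n v) := fun n v => hΦ2 _
  refine ⟨{ toFun := fun x => Φ x 0 1
            map_add' := fun x y => by simp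
            map_smul' := fun c x => by simp }, ?_, ?_, ?_, ?_⟩
  · intro a
    simp [hΦ1, matA]
  · intro a x
    simp only [LinearMap.coe_mk, AddHom.coe_mk, map_mul, Matrix.mul_apply, Fin.sum_univ_two, h11,
      hΦ1]
    simp [matA, add_comm]
  · intro n v
    simp [hy, matV, ftot_lof]
  · intro n v x
    simp only [LinearMap.coe_mk, AddHom.coe_mk, map_mul, Matrix.mul_apply, Fin.sum_univ_two, h11,
      hy]
    simp [matV, ftot_lof, yy]
    abel

/-- The differential of the model. -/
def dH (hW : ∀ n : ℕ, Even n → ∀ v : W.V n, v = 0) (F : VStr W A) :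
    HE A (Tot W) →ₗ[ℝ] HE A (Tot W) := (exists_dH hW F).choose

section dlemmas
variable (hW : ∀ n : ℕ, Even n → ∀ v : W.V n, v = 0) (F : VStr W A)

theorem dH_ii (a : A.carrier) : dH hW F (ii W A a) = ii W A (A.d a) :=
  (exists_dH hW F).choose_spec.1 a

theorem dH_ii_mul (a : A.carrier) (x : HE A (Tot W)) : dH hW F (ii W A a * x) =
    ii W A (A.d a) * x + ii W A (scale A (-1) a) * dH hW F x :=
  (exists_dH hW F).choose_spec.2.1 a x

theorem dH_yy (n : ℕ) (v : W.V n) : dH hW F (yy W A n v) = ii W A (F.f n v) :=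
  (exists_dH hW F).choose_spec.2.2.1 n v

theorem dH_yy_mul (n : ℕ) (v : W.V n) (x : HE A (Tot W)) : dH hW F (yy W A n v * x) =
    ii W A (F.f n v) * x - yy W A n v * dH hW F x :=
  (exists_dH hW F).choose_spec.2.2.2 n v x

theorem dH_dH (x : HE A (Tot W)) : dH hW F (dH hW F x) = 0 := by
  induction x using HE_ind hW with
  | hadd x y h1 h2 => rw [map_add, map_add, h1, h2, add_zero]
  | hi n a ha => rw [dH_ii, dH_ii, A.d_d, map_zero]
  | hy n v x hn hx =>
    rw [dH_yy_mul, map_sub, dH_ii_mul, dH_yy_mul, hx, F.f_closed, map_zero, zero_mul,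
      scale_mem A _ (F.f_mem n v), (hn.add_one).neg_one_pow, one_smul]
    simp

end dlemmas

/-! #### The grading -/

/-- Monomials of degree `n`. -/
inductive Mono (W : GradedVS) (A : CDGA) : ℕ → HE A (Tot W) → Prop
  | base {n : ℕ} (a : A.carrier) (ha : a ∈ A.grading n) : Mono W A n (ii W A a)
  | step {m n : ℕ} (v : W.V m) (x : HE A (Tot W)) (hm : Odd m) (hx : Mono W A n x) :
      Mono W A (m + n) (yy W A m v * x)

variable (W A) in
/-- The degree `n` part of the model. -/
def gr (n : ℕ) : Submodule ℝ (HE A (Tot W)) := Submodule.span ℝ {x | Mono W A n x}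

theorem mono_gr {n : ℕ} {x : HE A (Tot W)} (h : Mono W A n x) : x ∈ gr W A n :=
  Submodule.subset_span h

theorem gr_ind {n : ℕ} {P : (x : HE A (Tot W)) → x ∈ gr W A n → Prop}
    (hm : ∀ x (h : Mono W A n x), P x (mono_gr h)) (h0 : P 0 (Submodule.zero_mem _))
    (hadd : ∀ x y hx hy, P x hx → P y hy → P (x + y) (Submodule.add_mem _ hx hy))
    (hs : ∀ (c : ℝ) x hx, P x hx → P (c • x) (Submodule.smul_mem _ c hx))
    {x : HE A (Tot W)} (hx : x ∈ gr W A n) : P x hx := by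
  have key : ∃ h : x ∈ gr W A n, P x h := by
    have hx2 := hx
    unfold gr at hx2
    induction hx2 using Submodule.span_induction with
    | mem x h => exact ⟨_, hm x h⟩
    | zero => exact ⟨_, h0⟩
    | add x y h3 h4 h1 h2 =>
      obtain ⟨a, ha⟩ := h1 h3
      obtain ⟨b, hb⟩ := h2 h4
      exact ⟨_, hadd x y a b ha hb⟩
    | smul c x h3 h =>
      obtain ⟨a, ha⟩ := h h3
      exact ⟨_, hs c x a ha⟩
  exact key.2

theorem ii_gr {n : ℕ} {a : A.carrier} (ha : a ∈ A.grading n) : ii W A a ∈ gr W A n :=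
  mono_gr (.base a ha)

theorem yy_mul_gr (hW : ∀ n : ℕ, Even n → ∀ v : W.V n, v = 0) {m n : ℕ} (v : W.V m)
    {x : HE A (Tot W)} (hx : x ∈ gr W A n) : yy W A m v * x ∈ gr W A (m + n) := by
  rcases Nat.even_or_odd m with hm | hm
  · rw [hW m hm v]; simp
  induction hx using gr_ind with
  | hm x hx => exact mono_gr (.step v x hm hx)
  | h0 => simp
  | hadd x y _ _ h1 h2 => rw [mul_add]; exact Submodule.add_mem _ h1 h2
  | hs c x _ h => rw [mul_smul_comm]; exact Submodule.smul_mem _ _ h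

theorem ii_mul_gr (hW : ∀ n : ℕ, Even n → ∀ v : W.V n, v = 0) {m n : ℕ} {a : A.carrier}
    (ha : a ∈ A.grading m) {x : HE A (Tot W)} (hx : x ∈ gr W A n) :
    ii W A a * x ∈ gr W A (m + n) := by
  induction hx using gr_ind with
  | hm x hx =>
    induction hx with
    | base b hb => rw [← map_mul]; exact ii_gr (A.mul_mem ha hb)
    | @step p q v x hp hx ih =>
      have := yy_ii_mem (W := W) p v ha
      have h2 : ii W A a * (yy W A p v * x) = (-1 : ℝ) ^ m • (yy W A p v * (ii W A a * x)) := by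
        rw [← mul_assoc, ← mul_assoc, this, smul_mul_assoc, smul_smul, ← mul_pow]
        simp
      rw [h2, show m + (p + q) = p + (m + q) by ring]
      exact Submodule.smul_mem _ _ (yy_mul_gr hW v ih)
  | h0 => simp
  | hadd x y _ _ h1 h2 => rw [mul_add]; exact Submodule.add_mem _ h1 h2
  | hs c x _ h => rw [mul_smul_comm]; exact Submodule.smul_mem _ _ h

theorem gr_mul (hW : ∀ n : ℕ, Even n → ∀ v : W.V n, v = 0) {m n : ℕ} {x y : HE A (Tot W)}
    (hx : x ∈ gr W A m) (hy : y ∈ gr W A n) : x * y ∈ gr W A (m + n) := by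
  induction hx using gr_ind with
  | hm x hx =>
    induction hx with
    | base b hb => exact ii_mul_gr hW hb hy
    | @step p q v x hp hx ih =>
      rw [mul_assoc, add_assoc]
      exact yy_mul_gr hW v ih
  | h0 => simp
  | hadd x y _ _ h1 h2 => rw [add_mul]; exact Submodule.add_mem _ h1 h2
  | hs c x _ h => rw [smul_mul_assoc]; exact Submodule.smul_mem _ _ h

theorem sign1 {q : ℕ} (hq : Odd q) (n : ℕ) : (-1 : ℝ) ^ (q + n) = - (-1) ^ n := by
  rw [pow_add, hq.neg_one_pow, neg_one_mul]

theorem sign2 {q : ℕ} (hq : Odd q) (m n : ℕ) :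
    (-1 : ℝ) ^ (m * (q + n)) = (-1) ^ m * (-1) ^ (m * n) := by
  obtain ⟨k, rfl⟩ := hq
  rw [← pow_add, show m * (2 * k + 1 + n) = 2 * (m * k) + (m + m * n) by ring, pow_add, pow_mul]
  simp

theorem yy_comm_gr {m n : ℕ} (v : W.V m) {x : HE A (Tot W)} (hx : x ∈ gr W A n) :
    yy W A m v * x = (-1 : ℝ) ^ n • (x * yy W A m v) := by
  induction hx using gr_ind with
  | hm x hx =>
    induction hx with
    | base b hb => exact yy_ii_mem _ v hb
    | @step p q w x hp hx ih =>
      rw [← mul_assoc, yy_anti, neg_mul, mul_assoc, ih, sign1 hp, mul_smul_comm, neg_smul,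
        mul_assoc]
  | h0 => simp
  | hadd x y _ _ h1 h2 => rw [mul_add, add_mul, smul_add, h1, h2]
  | hs c x _ h => rw [mul_smul_comm, h, smul_mul_assoc, smul_comm]

theorem ii_comm_gr {m n : ℕ} {a : A.carrier} (ha : a ∈ A.grading m) {x : HE A (Tot W)}
    (hx : x ∈ gr W A n) : ii W A a * x = (-1 : ℝ) ^ (m * n) • (x * ii W A a) := by
  induction hx using gr_ind with
  | hm x hx =>
    induction hx with
    | base b hb => rw [← map_mul, A.gcomm ha hb, map_smul, map_mul]
    | @step p q w x hp hx ih =>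
      have := yy_ii_mem (W := W) p w ha
      have h2 : ii W A a * (yy W A p w * x) = (-1 : ℝ) ^ m • (yy W A p w * (ii W A a * x)) := by
        rw [← mul_assoc, ← mul_assoc, this, smul_mul_assoc, smul_smul, ← mul_pow]
        simp
      rw [h2, ih, mul_smul_comm, smul_smul, sign2 hp, mul_assoc]
  | h0 => simp
  | hadd x y _ _ h1 h2 => rw [mul_add, add_mul, smul_add, h1, h2]
  | hs c x _ h => rw [mul_smul_comm, h, smul_mul_assoc, smul_comm]

theorem gr_comm {m n : ℕ} {x y : HE A (Tot W)}
    (hx : x ∈ gr W A m) (hy : y ∈ gr W A n) : x * y = (-1 : ℝ) ^ (m * n) • (y * x) := by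
  induction hx using gr_ind with
  | hm x hx =>
    induction hx with
    | base b hb => exact ii_comm_gr hb hy
    | @step p q w x hp hx ih =>
      rw [mul_assoc, ih, mul_smul_comm, ← mul_assoc, yy_comm_gr w hy, smul_mul_assoc, smul_smul,
        mul_assoc, mul_comm (p + q) n, sign2 hp, mul_comm q n, mul_comm ((-1 : ℝ) ^ n)]
  | h0 => simp
  | hadd x y _ _ h1 h2 => rw [mul_add, add_mul, smul_add, h1, h2]
  | hs c x _ h => rw [mul_smul_comm, smul_mul_assoc, h, smul_comm]

theorem dH_gr (hW : ∀ n : ℕ, Even n → ∀ v : W.V n, v = 0) (F : VStr W A) {n : ℕ}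
    {x : HE A (Tot W)} (hx : x ∈ gr W A n) : dH hW F x ∈ gr W A (n + 1) := by
  induction hx using gr_ind with
  | hm x hx =>
    induction hx with
    | base b hb => rw [dH_ii]; exact ii_gr (A.d_mem hb)
    | @step p q w x hp hx ih =>
      rw [dH_yy_mul]
      refine Submodule.sub_mem _ ?_ ?_
      · have := ii_mul_gr hW (F.f_mem p w) (mono_gr hx)
        rwa [show p + 1 + q = p + q + 1 by ring] at this
      · have := yy_mul_gr hW w ih
        rwa [← add_assoc] at this
  | h0 => simp
  | hadd x y _ _ h1 h2 => rw [map_add]; exact Submodule.add_mem _ h1 h2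
  | hs c x _ h => rw [map_smul]; exact Submodule.smul_mem _ _ h

theorem dH_leibniz (hW : ∀ n : ℕ, Even n → ∀ v : W.V n, v = 0) (F : VStr W A) {n : ℕ}
    {x : HE A (Tot W)} (hx : x ∈ gr W A n) (y : HE A (Tot W)) :
    dH hW F (x * y) = dH hW F x * y + (-1 : ℝ) ^ n • (x * dH hW F y) := by
  induction hx using gr_ind with
  | hm x hx =>
    induction hx with
    | base b hb =>
      rw [dH_ii_mul, dH_ii, scale_mem A _ hb, map_smul, smul_mul_assoc]
    | @step p q w x hp hx ih =>
      rw [mul_assoc, dH_yy_mul, ih, dH_yy_mul, sign1 hp, mul_add, mul_smul_comm, sub_mul, neg_smul,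
        mul_assoc, mul_assoc, mul_assoc]
      abel
  | h0 => simp
  | hadd x y _ _ h1 h2 => simp only [map_add, add_mul, smul_add, h1, h2]; abel
  | hs c x _ h => simp only [map_smul, smul_mul_assoc, h, smul_add, smul_comm c]

/-- The scaling endomorphism of the model. -/
theorem exists_scaleH : ∃ Φ : HE A (Tot W) →ₐ[ℝ] HE A (Tot W),
    (∀ n, ∀ a ∈ A.grading n, Φ (ii W A a) = (2 : ℝ) ^ n • ii W A a) ∧
    ∀ n v, Φ (yy W A n v) = (2 : ℝ) ^ n • yy W A n v := by
  let s : Tot W →ₗ[ℝ] Tot W :=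
    DirectSum.toModule ℝ ℕ _ (fun n => (2 : ℝ) ^ n • DirectSum.lof ℝ ℕ W.V n)
  obtain ⟨Φ, h1, h2⟩ := HE_lift ((ii W A).comp (scale A 2)) (yH A (Tot W) ∘ₗ s)
    (fun v => yH_sq _ _ _) (by
      intro v n a ha
      simp only [AlgHom.comp_apply, LinearMap.comp_apply]
      rw [yH_iH]
      simp only [scale_mem A _ ha, map_smul, smul_mul_assoc]
      rw [smul_comm])
  refine ⟨Φ, fun n a ha => ?_, fun n v => ?_⟩
  · rw [h1, AlgHom.comp_apply, scale_mem A _ ha, map_smul]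
  · simp only [yy, LinearMap.comp_apply, h2]
    simp only [s, DirectSum.toModule_lof, LinearMap.smul_apply, map_smul]

theorem gr_internal (hW : ∀ n : ℕ, Even n → ∀ v : W.V n, v = 0) :
    DirectSum.IsInternal (gr W A) := by
  rw [DirectSum.isInternal_submodule_iff_iSupIndep_and_iSup_eq_top]
  constructor
  · obtain ⟨Φ, h1, h2⟩ := exists_scaleH (W := W) (A := A)
    have hle : ∀ n, gr W A n ≤ Module.End.eigenspace (Φ.toLinearMap) ((2 : ℝ) ^ n) := by
      intro n x hx
      rw [Module.End.mem_eigenspace_iff]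
      change Φ x = _
      induction hx using gr_ind with
      | hm x hx =>
        induction hx with
        | base b hb => exact h1 _ _ hb
        | @step p q w x hp hx ih =>
          rw [map_mul, h2, ih, smul_mul_smul_comm, pow_add]
      | h0 => simp
      | hadd x y _ _ h1 h2 => rw [map_add, h1, h2, smul_add]
      | hs c x _ h => rw [map_smul, h, smul_comm]
    have hind := Module.End.eigenspaces_iSupIndep (Φ.toLinearMap)
    have hinj : Function.Injective (fun n : ℕ => (2 : ℝ) ^ n) :=
      pow_right_injective₀ (by norm_num) (by norm_num)
    exact (hind.comp hinj).mono hle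
  · rw [Submodule.eq_top_iff']
    intro x
    induction x using HE_ind hW with
    | hadd x y h1 h2 => exact Submodule.add_mem _ h1 h2
    | hi n a ha => exact Submodule.mem_iSup_of_mem n (ii_gr ha)
    | hy n v x hn hx =>
      induction hx using Submodule.iSup_induction' with
      | mem i x hx => exact Submodule.mem_iSup_of_mem _ (yy_mul_gr hW v hx)
      | zero => simp
      | add x y _ _ h1 h2 => rw [mul_add]; exact Submodule.add_mem _ h1 h2

/-- The model of the Hirsch extension. -/
def model (hW : ∀ n : ℕ, Even n → ∀ v : W.V n, v = 0) (F : VStr W A) : CDGA where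
  carrier := HE A (Tot W)
  grading := gr W A
  one_mem := by
    rw [← map_one (ii W A)]
    exact ii_gr A.one_mem
  mul_mem := gr_mul hW
  internal := gr_internal hW
  gcomm := gr_comm
  d := dH hW F
  d_mem := dH_gr hW F
  d_d := dH_dH hW F
  leibniz := dH_leibniz hW F

/-! #### The universal property -/

def homAlg {S T : CDGA} (φ : CDGAHom S T) : S.carrier →ₐ[ℝ] T.carrier :=
  AlgHom.ofLinearMap φ.toLin φ.map_one φ.map_mul

theorem homAlg_apply {S T : CDGA} (φ : CDGAHom S T) (x : S.carrier) : homAlg φ x = φ.toLin x := rfl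

def modelIncl (hW : ∀ n : ℕ, Even n → ∀ v : W.V n, v = 0) (F : VStr W A) :
    CDGAHom A (model hW F) where
  toLin := (ii W A).toLinearMap
  map_one := map_one (ii W A)
  map_mul := map_mul (ii W A)
  map_grading h := ii_gr h
  map_d a := (dH_ii hW F a).symm

theorem model_exists (hW : ∀ n : ℕ, Even n → ∀ v : W.V n, v = 0) (F : VStr W A) (C : CDGA)
    (ψ : CDGAHom A C) (k : ∀ n, W.V n →ₗ[ℝ] C.carrier) (hk : ∀ n v, k n v ∈ C.grading n)
    (hd : ∀ n v, C.d (k n v) = ψ.toLin (F.f n v)) :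
    ∃ Φ : CDGAHom (model hW F) C, (∀ a, Φ.toLin (ii W A a) = ψ.toLin a) ∧
      ∀ v, Φ.toLin (yH A (Tot W) v) = DirectSum.toModule ℝ ℕ C.carrier k v := by
  let K : Tot W →ₗ[ℝ] C.carrier := DirectSum.toModule ℝ ℕ C.carrier k
  have hK : ∀ n v, K (DirectSum.lof ℝ ℕ W.V n v) = k n v := fun n v => DirectSum.toModule_lof _ _ _
  have hanti : ∀ v w, K v * K w = - (K w * K v) := by
    intro v w
    induction v using tot_ind with
    | h0 => simp
    | hadd a b h1 h2 => simp only [map_add, add_mul, mul_add, h1, h2]; abel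
    | hs m v =>
      induction w using tot_ind with
      | h0 => simp
      | hadd a b h1 h2 => simp only [map_add, add_mul, mul_add, h1, h2]; abel
      | hs n w =>
        rw [hK, hK]
        rcases Nat.even_or_odd m with hm | hm
        · rw [hW m hm v]; simp
        rcases Nat.even_or_odd n with hn | hn
        · rw [hW n hn w]; simp
        rw [C.gcomm (hk m v) (hk n w), (hm.mul hn).neg_one_pow, neg_one_smul]
  have hsq : ∀ v, K v * K v = 0 := by
    intro v
    have h := hanti v v
    have h2 : (2 : ℝ) • (K v * K v) = 0 := by
      rw [two_smul]
      nth_rewrite 1 [h]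
      simp
    exact (smul_eq_zero.1 h2).resolve_left (by norm_num)
  have hcomm : ∀ v n, ∀ a ∈ A.grading n,
      K v * homAlg ψ a = (-1 : ℝ) ^ n • (homAlg ψ a * K v) := by
    intro v n a ha
    induction v using tot_ind with
    | h0 => simp
    | hadd a b h1 h2 => simp only [map_add, add_mul, mul_add, smul_add, h1, h2]
    | hs m v =>
      rw [hK]
      rcases Nat.even_or_odd m with hm | hm
      · rw [hW m hm v]; simp
      rw [homAlg_apply, C.gcomm (hk m v) (ψ.map_grading ha), pow_mul, hm.neg_one_pow]
  obtain ⟨Φ, h1, h2⟩ := HE_lift (homAlg ψ) K hsq hcomm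
  have h3 : ∀ n v, Φ (yy W A n v) = k n v := fun n v => (h2 _).trans (hK n v)
  refine ⟨{ toLin := Φ.toLinearMap, map_one := map_one Φ, map_mul := map_mul Φ,
            map_grading := ?_, map_d := ?_ }, h1, h2⟩
  · intro n x hx
    change Φ x ∈ _
    change x ∈ gr W A n at hx
    induction hx using gr_ind with
    | hm x hx =>
      induction hx with
      | base b hb => rw [h1]; exact ψ.map_grading hb
      | @step p q w x hp hx ih =>
        rw [map_mul, h3]
        exact C.mul_mem (hk _ _) ih
    | h0 => simp
    | hadd x y _ _ h1 h2 => rw [map_add]; exact Submodule.add_mem _ h1 h2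
    | hs c x _ h => rw [map_smul]; exact Submodule.smul_mem _ _ h
  · intro x
    change Φ (dH hW F x) = C.d (Φ x)
    induction x using HE_ind hW with
    | hadd x y h1 h2 => simp only [map_add, h1, h2]
    | hi n a ha => rw [dH_ii, h1, h1, homAlg_apply, homAlg_apply, ψ.map_d]
    | hy n v x hn hx =>
      rw [dH_yy_mul, map_sub, map_mul, map_mul, map_mul, h1, h3, hx, C.leibniz (hk n v), hd,
        homAlg_apply, hn.neg_one_pow, neg_one_smul, sub_eq_add_neg]

def modelIsHirsch (hW : ∀ n : ℕ, Even n → ∀ v : W.V n, v = 0) (F : VStr W A) :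
    IsHirschExt W F (model hW F) where
  incl := modelIncl hW F
  j := yy W A
  j_mem n v := by
    have := yy_mul_gr (A := A) hW v (ii_gr A.one_mem)
    rw [map_one, mul_one] at this
    exact this
  dj n v := dH_yy hW F n v
  universal C ψ k hk hd := by
    obtain ⟨Φ, h1, h2⟩ := model_exists hW F C ψ k hk hd
    have h3 : ∀ n v, Φ.toLin (yy W A n v) = k n v := fun n v =>
      (h2 _).trans (DirectSum.toModule_lof _ _ _)
    refine ⟨Φ, ⟨h1, h3⟩, ?_⟩
    rintro Ψ ⟨g1, g2⟩
    apply hom_ext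
    intro x
    change HE A (Tot W) at x
    induction x using HE_ind hW with
    | hadd x y h1 h2 =>
      exact (map_add Ψ.toLin x y).trans
        ((congrArg₂ (· + ·) h1 h2).trans (map_add Φ.toLin x y).symm)
    | hi n a ha => exact (g1 a).trans (h1 a).symm
    | hy n v x hn hx =>
      exact (Ψ.map_mul (yy W A n v) x).trans
        ((congrArg₂ (· * ·) ((g2 n v).trans (h3 n v).symm) hx).trans
          (Φ.map_mul (yy W A n v) x).symm)

end
end Hirsch


namespace Hirsch
open scoped TensorProduct DirectSum

/-! ### The filtration by word length -/

section filt
variable (V : Type) [AddCommGroup V] [Module ℝ V]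

/-- Index set of a homogeneous basis of the exterior algebra. -/
abbrev KK : Type := Σ j : ℕ, Module.Free.ChooseBasisIndex ℝ (⋀[ℝ]^j V)

theorem ext_internal : DirectSum.IsInternal (fun i : ℕ => ⋀[ℝ]^i V) :=
  DirectSum.Decomposition.isInternal _

/-- A homogeneous basis of the exterior algebra. -/
def bb : Module.Basis (KK V) ℝ (ExteriorAlgebra ℝ V) :=
  (ext_internal V).collectedBasis (fun j => Module.Free.chooseBasis ℝ (⋀[ℝ]^j V))

theorem bb_mem (k : KK V) : bb V k ∈ ⋀[ℝ]^k.1 V :=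
  (ext_internal V).collectedBasis_mem (fun j => Module.Free.chooseBasis ℝ (⋀[ℝ]^j V)) k

theorem bb_repr {j : ℕ} {w : ExteriorAlgebra ℝ V} (hw : w ∈ ⋀[ℝ]^j V) (k : KK V) (h : j ≠ k.1) :
    (bb V).repr w k = 0 :=
  (ext_internal V).collectedBasis_repr_of_mem_ne
    (fun j => Module.Free.chooseBasis ℝ (⋀[ℝ]^j V)) h hw

variable (A : CDGA)

open Classical in
/-- Coordinates on `A ⊗ ∧V`. -/
def CC : HE A V ≃ₗ[ℝ] (KK V →₀ A.carrier) :=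
  (tH A V).symm ≪≫ₗ TensorProduct.equivFinsuppOfBasisRight (bb V)

variable {V A}

theorem CC_apply (a : A.carrier) (w : ExteriorAlgebra ℝ V) (k : KK V) :
    CC V A (iH A V a * rH A V w) k = (bb V).repr w k • a := by
  classical
  rw [← tH_tmul]
  simp only [CC, LinearEquiv.trans_apply, LinearEquiv.symm_apply_apply]
  convert TensorProduct.equivFinsuppOfBasisRight_apply_tmul_apply (bb V) a w k

theorem CC_single (k : KK V) (a : A.carrier) :
    (CC V A).symm (Finsupp.single k a) = iH A V a * rH A V (bb V k) := by
  rw [LinearEquiv.symm_apply_eq]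
  ext l
  rw [CC_apply, Module.Basis.repr_self, Finsupp.single_apply, Finsupp.single_apply]
  split <;> simp

theorem CC_ind {P : HE A V → Prop} (h0 : P 0) (hadd : ∀ x y, P x → P y → P (x + y))
    (x : HE A V) (hs : ∀ a k, CC V A x k ≠ 0 → P (iH A V a * rH A V (bb V k))) : P x := by
  have hx : x = (CC V A).symm ((CC V A) x) := by simp
  rw [hx, ← Finsupp.sum_single ((CC V A) x), Finsupp.sum, map_sum]
  refine Finset.sum_induction _ P hadd h0 ?_
  intro k hk
  rw [CC_single]
  exact hs _ _ (Finsupp.mem_support_iff.1 hk)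

variable (V A) in
/-- The filtration by word length. -/
def FF (p : ℕ) : Submodule ℝ (HE A V) where
  carrier := {x | ∀ k : KK V, p ≤ k.1 → CC V A x k = 0}
  zero_mem' := by intro k _; simp
  add_mem' := by
    intro x y hx hy k hk
    rw [map_add, Finsupp.add_apply, hx k hk, hy k hk, add_zero]
  smul_mem' := by
    intro c x hx k hk
    rw [map_smul, Finsupp.smul_apply, hx k hk, smul_zero]

theorem FF_zero {x : HE A V} (hx : x ∈ FF V A 0) : x = 0 := by
  apply (CC V A).injective
  ext k
  rw [hx k (Nat.zero_le _)]
  simp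

theorem FF_mono {p q : ℕ} (h : p ≤ q) {x : HE A V} (hx : x ∈ FF V A p) : x ∈ FF V A q :=
  fun k hk => hx k (h.trans hk)

theorem FF_exists (x : HE A V) : ∃ p, x ∈ FF V A p := by
  refine ⟨((CC V A x).support.sup fun k => k.1) + 1, fun k hk => ?_⟩
  by_contra hne
  have := Finset.le_sup (f := fun k : KK V => k.1) (Finsupp.mem_support_iff.2 hne)
  omega

theorem FF_basic {j : ℕ} (a : A.carrier) {w : ExteriorAlgebra ℝ V} (hw : w ∈ ⋀[ℝ]^j V) :
    iH A V a * rH A V w ∈ FF V A (j + 1) := by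
  intro k hk
  rw [CC_apply, bb_repr V hw k (by omega), zero_smul]

theorem FF_ind {p : ℕ} {P : HE A V → Prop} (h0 : P 0) (hadd : ∀ x y, P x → P y → P (x + y))
    (hs : ∀ a (k : KK V), k.1 < p → P (iH A V a * rH A V (bb V k)))
    {x : HE A V} (hx : x ∈ FF V A p) : P x := by
  refine CC_ind h0 hadd x fun a k hk => hs a k ?_
  by_contra h
  exact hk (hx k (not_lt.1 h))

theorem FF_iH {p : ℕ} (a : A.carrier) {x : HE A V} (hx : x ∈ FF V A p) :
    iH A V a * x ∈ FF V A p := by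
  refine FF_ind (p := p) (P := fun x => iH A V a * x ∈ FF V A p) ?_ ?_ ?_ hx
  · simp
  · intro x y h1 h2
    rw [mul_add]
    exact Submodule.add_mem _ h1 h2
  · intro b k hk
    rw [← mul_assoc, ← map_mul]
    exact FF_mono hk (FF_basic _ (bb_mem V k))

theorem FF_yH {p : ℕ} (v : V) {x : HE A V} (hx : x ∈ FF V A p) :
    yH A V v * x ∈ FF V A (p + 1) := by
  refine FF_ind (p := p) (P := fun x => yH A V v * x ∈ FF V A (p + 1)) ?_ ?_ ?_ hx
  · simp
  · intro x y h1 h2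
    rw [mul_add]
    exact Submodule.add_mem _ h1 h2
  · intro b k hk
    rw [← mul_assoc, yH_iH, mul_assoc]
    have e : yH A V v * rH A V (bb V k) = rH A V (ExteriorAlgebra.ι ℝ v * bb V k) := by
      rw [map_mul]; rfl
    rw [e]
    have hm : ExteriorAlgebra.ι ℝ v * bb V k ∈ ⋀[ℝ]^(k.1 + 1) V := by
      change _ ∈ (LinearMap.range (ExteriorAlgebra.ι ℝ)) ^ (k.1 + 1)
      rw [pow_succ']
      exact Submodule.mul_mem_mul (LinearMap.mem_range_self _ v) (bb_mem V k)
    exact FF_mono (by omega) (FF_basic _ hm)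

end filt

section
variable {W : GradedVS} {A : CDGA} (hW : ∀ n : ℕ, Even n → ∀ v : W.V n, v = 0) (F : VStr W A)

theorem dH_yH_mul (v : Tot W) (x : HE A (Tot W)) : dH hW F (yH A (Tot W) v * x) =
    ii W A (ftot F v) * x - yH A (Tot W) v * dH hW F x := by
  induction v using tot_ind with
  | h0 => simp
  | hadd v w h1 h2 => simp only [map_add, add_mul, h1, h2]; abel
  | hs n v => rw [ftot_lof]; exact dH_yy_mul hW F n v x

theorem d_one (A : CDGA) : A.d 1 = 0 := by
  have := leibniz_scale A 1 1
  simpa using this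

theorem dH_rH {j : ℕ} {w : ExteriorAlgebra ℝ (Tot W)} (hw : w ∈ ⋀[ℝ]^j (Tot W)) :
    dH hW F (rH A (Tot W) w) ∈ FF (Tot W) A j := by
  induction hw using Submodule.pow_induction_on_left' with
  | algebraMap r =>
    rw [AlgHom.commutes, ← (ii W A).commutes r, dH_ii, Algebra.algebraMap_eq_smul_one, map_smul,
      d_one]
    simp
  | add x y i _ _ h1 h2 => rw [map_add, map_add]; exact Submodule.add_mem _ h1 h2
  | mem_mul m hm j x hx ih =>
    obtain ⟨v, rfl⟩ := hm
    rw [map_mul]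
    change dH hW F (yH A (Tot W) v * _) ∈ _
    rw [dH_yH_mul]
    exact Submodule.sub_mem _ (FF_basic _ hx) (FF_yH v ih)

theorem CC_dH {p : ℕ} {x : HE A (Tot W)} (hx : x ∈ FF (Tot W) A (p + 1)) (k : KK (Tot W))
    (hk : p ≤ k.1) : CC (Tot W) A (dH hW F x) k = A.d (CC (Tot W) A x k) := by
  refine FF_ind (p := p + 1)
    (P := fun x => CC (Tot W) A (dH hW F x) k = A.d (CC (Tot W) A x k)) ?_ ?_ ?_ hx
  · simp
  · intro x y h1 h2
    simp only [map_add, Finsupp.add_apply, h1, h2]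
  · intro a l hl
    have h1 : CC (Tot W) A (ii W A (scale A (-1) a) * dH hW F (rH A (Tot W) (bb (Tot W) l))) k
        = 0 := FF_iH _ (dH_rH hW F (bb_mem _ l)) k (by omega)
    rw [dH_ii_mul, map_add, Finsupp.add_apply, h1, CC_apply, CC_apply, add_zero, map_smul]

theorem FF_dH {p : ℕ} {x : HE A (Tot W)} (hx : x ∈ FF (Tot W) A p) :
    dH hW F x ∈ FF (Tot W) A p := by
  intro k hk
  rw [CC_dH hW F (FF_mono (Nat.le_succ p) hx) k hk, hx k hk, map_zero]

/-- Push-forward of a structure map. -/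
def push {S T : CDGA} (φ : CDGAHom S T) (F : VStr W S) : VStr W T where
  f n := φ.toLin ∘ₗ F.f n
  f_mem n v := φ.map_grading (F.f_mem n v)
  f_closed n v := by
    simp only [LinearMap.comp_apply]
    rw [← φ.map_d, F.f_closed, map_zero]

variable {S T : CDGA} (φ : CDGAHom S T)

theorem push_exists (F : VStr W S) : ∃ Φ : CDGAHom (model hW F) (model hW (push φ F)),
    ∀ a w, Φ.toLin (iH S (Tot W) a * rH S (Tot W) w : HE S (Tot W)) =
      (iH T (Tot W) (φ.toLin a) * rH T (Tot W) w : HE T (Tot W)) := by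
  let M := modelIsHirsch hW (push φ F)
  obtain ⟨Φ, h1, h2⟩ := model_exists hW F (model hW (push φ F)) (compHom M.incl φ)
    M.j M.j_mem M.dj
  have h3 : ∀ v, Φ.toLin (yH S (Tot W) v) = yH T (Tot W) v := by
    intro v
    refine (h2 v).trans ?_
    change DirectSum.toModule ℝ ℕ (HE T (Tot W)) (yy W T) v = _
    induction v using tot_ind with
    | h0 => simp
    | hadd v w h1 h2 => rw [map_add, map_add, h1, h2]
    | hs n v => rw [DirectSum.toModule_lof]; rfl
  let ΦA : HE S (Tot W) →ₐ[ℝ] HE T (Tot W) := homAlg Φ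
  have h4 : ΦA.comp (rH S (Tot W)) = rH T (Tot W) := by
    apply ExteriorAlgebra.hom_ext
    exact LinearMap.ext fun v => h3 v
  refine ⟨Φ, fun a w => ?_⟩
  change ΦA _ = _
  rw [map_mul]
  exact congrArg₂ (· * ·) (h1 a) (DFunLike.congr_fun h4 w)

theorem push_quasiIso (F : VStr W S) (hφ : φ.IsQuasiIso) :
    DirectQIso (model hW F) (model hW (push φ F)) := by
  obtain ⟨Φ, hΦ⟩ := push_exists hW φ F
  refine ⟨Φ, ?_⟩
  apply quasiIso_of_cone
  have hcone := cone_of_quasiIso φ hφ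
  let Ψ : HE S (Tot W) →ₗ[ℝ] HE T (Tot W) := Φ.toLin
  let dS : HE S (Tot W) →ₗ[ℝ] HE S (Tot W) := dH hW F
  let dT : HE T (Tot W) →ₗ[ℝ] HE T (Tot W) := dH hW (push φ F)
  have hΨd : ∀ x, Ψ (dS x) = dT (Ψ x) := Φ.map_d
  have hdS : ∀ x, dS (dS x) = 0 := dH_dH hW F
  have hdT : ∀ x, dT (dT x) = 0 := dH_dH hW _
  have hΨC : ∀ x k, CC (Tot W) T (Ψ x) k = φ.toLin (CC (Tot W) S x k) := by
    intro x k
    refine CC_ind (P := fun x => CC (Tot W) T (Ψ x) k = φ.toLin (CC (Tot W) S x k)) ?_ ?_ x ?_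
    · simp
    · intro x y h1 h2
      simp only [map_add, Finsupp.add_apply, h1, h2]
    · intro a l _
      have : Ψ (iH S (Tot W) a * rH S (Tot W) (bb (Tot W) l)) = _ := hΦ a _
      rw [this, CC_apply, CC_apply, map_smul]
  have hΨF : ∀ p x, x ∈ FF (Tot W) S p → Ψ x ∈ FF (Tot W) T p := by
    intro p x hx k hk
    rw [hΨC, hx k hk, map_zero]
  have main : ∀ p, ∀ x ∈ FF (Tot W) S p, ∀ y ∈ FF (Tot W) T p, dS x = 0 → Ψ x = dT y →
      ∃ x' y', dS x' = x ∧ Ψ x' - y = dT y' := by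
    intro p
    induction p with
    | zero =>
      intro x hx y hy _ _
      refine ⟨0, 0, ?_, ?_⟩
      · rw [FF_zero hx, map_zero]
      · rw [FF_zero hy]; simp
    | succ p ih =>
      intro x hx y hy hdx hxy
      have hex : ∀ k : KK (Tot W), ∃ a b, (k.1 = p → S.d a = CC (Tot W) S x k ∧
          φ.toLin a - CC (Tot W) T y k = T.d b) ∧
          (k.1 ≠ p ∨ (CC (Tot W) S x k = 0 ∧ CC (Tot W) T y k = 0) → a = 0 ∧ b = 0) := by
        intro k
        by_cases h : k.1 ≠ p ∨ (CC (Tot W) S x k = 0 ∧ CC (Tot W) T y k = 0)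
        · refine ⟨0, 0, fun hk => ?_, fun _ => ⟨rfl, rfl⟩⟩
          obtain ⟨e1, e2⟩ := h.resolve_left (not_not.2 hk)
          rw [e1, e2]
          simp
        · have hk : k.1 = p := by
            by_contra hk
            exact h (Or.inl hk)
          have e1 : S.d (CC (Tot W) S x k) = 0 := by
            rw [← CC_dH hW F hx k hk.ge]
            change CC (Tot W) S (dS x) k = 0
            rw [hdx]; simp
          have e2 : φ.toLin (CC (Tot W) S x k) = T.d (CC (Tot W) T y k) := by
            rw [← CC_dH hW (push φ F) hy k hk.ge, ← hΨC, hxy]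
          obtain ⟨a, b, h1, h2⟩ := hcone _ _ e1 e2
          exact ⟨a, b, fun _ => ⟨h1, h2⟩, fun h' => absurd h' h⟩
      choose a b hab1 hab2 using hex
      classical
      let s : Finset (KK (Tot W)) := (CC (Tot W) S x).support ∪ (CC (Tot W) T y).support
      have hs : ∀ k, k ∉ s → a k = 0 ∧ b k = 0 := by
        intro k hk
        simp only [s, Finset.mem_union, Finsupp.mem_support_iff, not_or, not_not] at hk
        exact hab2 k (Or.inr hk)
      let x1 : HE S (Tot W) := (CC (Tot W) S).symm
        (Finsupp.onFinset s a fun k hk => by_contra fun h => hk (hs k h).1)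
      let y1 : HE T (Tot W) := (CC (Tot W) T).symm
        (Finsupp.onFinset s b fun k hk => by_contra fun h => hk (hs k h).2)
      have hx1 : ∀ k, CC (Tot W) S x1 k = a k := fun k => by simp [x1]
      have hy1 : ∀ k, CC (Tot W) T y1 k = b k := fun k => by simp [y1]
      have fx1 : x1 ∈ FF (Tot W) S (p + 1) := fun k hk => by
        rw [hx1]; exact (hab2 k (Or.inl (by omega))).1
      have fy1 : y1 ∈ FF (Tot W) T (p + 1) := fun k hk => by
        rw [hy1]; exact (hab2 k (Or.inl (by omega))).2
      have fdx1 : dS x1 ∈ FF (Tot W) S (p + 1) := FF_dH hW F fx1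
      have fdy1 : dT y1 ∈ FF (Tot W) T (p + 1) := FF_dH hW _ fy1
      have cdx1 : ∀ k : KK (Tot W), k.1 = p → CC (Tot W) S (dS x1) k = S.d (a k) := fun k hk => by
        rw [← hx1]; exact CC_dH hW F fx1 k hk.ge
      have cdy1 : ∀ k : KK (Tot W), k.1 = p → CC (Tot W) T (dT y1) k = T.d (b k) := fun k hk => by
        rw [← hy1]; exact CC_dH hW _ fy1 k hk.ge
      have g1 : x - dS x1 ∈ FF (Tot W) S p := by
        intro k hk
        rcases hk.eq_or_lt with hk | hk
        · rw [map_sub, Finsupp.sub_apply, cdx1 k hk.symm, (hab1 k hk.symm).1, sub_self]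
        · exact Submodule.sub_mem _ hx fdx1 k hk
      have g2 : y - Ψ x1 + dT y1 ∈ FF (Tot W) T p := by
        intro k hk
        rcases hk.eq_or_lt with hk | hk
        · rw [map_add, map_sub, Finsupp.add_apply, Finsupp.sub_apply, cdy1 k hk.symm, hΨC, hx1,
            ← (hab1 k hk.symm).2]
          abel
        · exact Submodule.add_mem _ (Submodule.sub_mem _ hy (hΨF _ _ fx1)) fdy1 k hk
      obtain ⟨x3, y3, h3, h4⟩ := ih _ g1 _ g2 (by rw [map_sub, hdx, hdS, sub_zero])
        (by rw [map_sub, map_add, map_sub, hxy, hdT, hΨd, add_zero])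
      refine ⟨x1 + x3, y1 + y3, ?_, ?_⟩
      · rw [map_add, h3]; abel
      · rw [map_add, map_add, ← h4]; abel
  intro x y hdx hxy
  obtain ⟨p, hp⟩ := FF_exists (V := Tot W) (A := S) x
  obtain ⟨q, hq⟩ := FF_exists (V := Tot W) (A := T) y
  exact main (max p q) x (FF_mono (le_max_left _ _) hp) y (FF_mono (le_max_right _ _) hq) hdx hxy

end
end Hirsch


namespace Hirsch
open scoped TensorProduct DirectSum

/-! ### Induction along the zigzag -/

variable {W : GradedVS}

theorem exists_primitive {T : CDGA} (n : ℕ) {X : Type} [AddCommGroup X] [Module ℝ X]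
    (L : X →ₗ[ℝ] T.carrier) (hL : ∀ v, L v ∈ T.coboundaries (n + 1)) :
    ∃ h : X →ₗ[ℝ] T.carrier, (∀ v, h v ∈ T.grading n) ∧ ∀ v, T.d (h v) = L v := by
  let g : ↥(T.grading n) →ₗ[ℝ] ↥(T.coboundaries (n + 1)) :=
    (T.d ∘ₗ (T.grading n).subtype).codRestrict _ (fun x => ⟨x, x.2, rfl⟩)
  have hg : Function.Surjective g := by
    rintro ⟨x, y, hy, rfl⟩
    exact ⟨⟨y, hy⟩, rfl⟩
  obtain ⟨h, hh⟩ := Module.projective_lifting_property g (L.codRestrict _ hL) hg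
  refine ⟨(T.grading n).subtype ∘ₗ h, fun v => (h v).2, fun v => ?_⟩
  exact congrArg Subtype.val (DFunLike.congr_fun hh v)

theorem qiso_of_cohomologous {A : CDGA} (F F' : VStr W A)
    (hs : ∀ n v, F.fsharp n v = F'.fsharp n v)
    (E E' : CDGA) (hE : IsHirschExt W F E) (hE' : IsHirschExt W F' E') : QIso E E' := by
  have hex : ∀ n, ∃ h : W.V n →ₗ[ℝ] A.carrier, (∀ v, h v ∈ A.grading n) ∧
      ∀ v, A.d (h v) = F.f n v - F'.f n v := fun n =>
    exists_primitive n (F.f n - F'.f n) fun v => (Submodule.Quotient.eq (A.Hsub (n + 1))).1 (hs n v)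
  choose h h1 h2 using hex
  exact Relation.EqvGen.rel _ _ (directQIso_of_cohomologous F F' h h1 h2 E E' hE hE')

theorem push_fsharp {S T : CDGA} (φ : CDGAHom S T) (F : VStr W S) (n : ℕ) (v : W.V n) :
    (push φ F).fsharp n v = φ.Hmap (n + 1) (F.fsharp n v) := rfl

/-- The map `f^♯` as a linear map. -/
def fsharpLin {A : CDGA} (F : VStr W A) (n : ℕ) : W.V n →ₗ[ℝ] A.H (n + 1) :=
  (A.Hsub (n + 1)).mkQ ∘ₗ (F.f n).codRestrict _ (fun v => Submodule.mem_inf.mpr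
    ⟨LinearMap.mem_ker.mpr (F.f_closed n v), F.f_mem n v⟩)

theorem fsharpLin_apply {A : CDGA} (F : VStr W A) (n : ℕ) (v : W.V n) :
    fsharpLin F n v = F.fsharp n v := rfl

theorem exists_vstr {A : CDGA} (L : ∀ n, W.V n →ₗ[ℝ] A.H (n + 1)) :
    ∃ F : VStr W A, ∀ n v, F.fsharp n v = L n v := by
  have hex : ∀ n, ∃ h : W.V n →ₗ[ℝ] ↥(A.cocycles (n + 1)), (A.Hsub (n + 1)).mkQ ∘ₗ h = L n :=
    fun n => Module.projective_lifting_property _ _ (Submodule.mkQ_surjective _)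
  choose h hh using hex
  exact ⟨{ f := fun n => (A.cocycles (n + 1)).subtype ∘ₗ h n
           f_mem := fun n v => (Submodule.mem_inf.1 (h n v).2).2
           f_closed := fun n v => LinearMap.mem_ker.1 (Submodule.mem_inf.1 (h n v).2).1 },
    fun n v => DFunLike.congr_fun (hh n) v⟩

theorem zigzag_main (hW : ∀ n : ℕ, Even n → ∀ v : W.V n, v = 0) {S T : CDGA}
    {γ : ∀ n, S.H n →ₗ[ℝ] T.H n} (hγ : ZigzagInduces S T γ) :
    ∀ (FS : VStr W S) (FT : VStr W T)
      (_ : ∀ (n : ℕ) (v : W.V n), FT.fsharp n v = γ (n + 1) (FS.fsharp n v))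
      (E E' : CDGA) (_ : IsHirschExt W FS E) (_ : IsHirschExt W FT E'), QIso E E' := by
  induction hγ with
  | direct φ hφ =>
    intro FS FT hc E E' hE hE'
    refine (qiso_of_cohomologous FS FS (fun _ _ => rfl) E _ hE (modelIsHirsch hW FS)).trans _ _ _
      (Relation.EqvGen.trans _ _ _ (Relation.EqvGen.rel _ _ (push_quasiIso hW φ FS hφ)) ?_)
    refine qiso_of_cohomologous (push φ FS) FT (fun n v => ?_) _ _ (modelIsHirsch hW _) hE'
    rw [hc, push_fsharp]
  | symm γ γ' h hl hr ih =>
    intro FS FT hc E E' hE hE'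
    refine Relation.EqvGen.symm _ _ (ih FT FS (fun n v => ?_) E' E hE' hE)
    rw [hc, hr]
  | trans γ₁ γ₂ h₁ h₂ ih₁ ih₂ =>
    intro FS FT hc E E' hE hE'
    obtain ⟨FM, hFM⟩ := exists_vstr fun n => (γ₁ (n + 1)) ∘ₗ fsharpLin FS n
    refine Relation.EqvGen.trans _ _ _
      (ih₁ FS FM (fun n v => hFM n v) E (model hW FM) hE (modelIsHirsch hW FM))
      (ih₂ FM FT (fun n v => ?_) _ E' (modelIsHirsch hW FM) hE')
    rw [hc, hFM]
    rfl

end Hirsch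

/-- if `(A, d, f)` is a `V`-CDGA with `V` concentrated in odd degrees
and `(A, d)` formal, then `(A ⊗ ∧V, d_f)` is quasi-isomorphic to
`(H*(A) ⊗ ∧V, d_{f^♯})`; here `HA` realizes the cohomology `H*(A)` (a CDGA with zero
differential zigzag-quasi-isomorphic to `A`, which exists by formality) and `FH`
corresponds to `f^♯` under the induced isomorphism `γ`. -/
theorem statement16 (W : GradedVS) (hW : ∀ n : ℕ, Even n → ∀ v : W.V n, v = 0)
    (A : CDGA) (FA : VStr W A)
    (HA : CDGA) (hHAd : HA.d = 0)
    (γ : ∀ n, A.H n →ₗ[ℝ] HA.H n) (hγ : ZigzagInduces A HA γ)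
    (FH : VStr W HA)
    (hcomp : ∀ (n : ℕ) (v : W.V n), FH.fsharp n v = γ (n + 1) (FA.fsharp n v))
    (E E' : CDGA) (hE : IsHirschExt W FA E) (hE' : IsHirschExt W FH E') :
    QIso E E' := by
  exact Hirsch.zigzag_main hW hγ FA FH hcomp E E' hE hE'
end
end
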